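/- arXiv:1605.07755 — 7 statements merged into one kernel-verified Lean document; each statement's English description precedes it below -/
import Mathlib

section
/- Let p₁, …, pₙ ∈ D(1/2) and k₁, …, kₙ ∈ ℝ satisfy Σₛ max(kₛ, 0) < 2π. Let z, z' ∈ D(1/2) and γ(t) = (1−t)z + t z'. Then ∫₀¹ (∏ₛ |γ(t) − pₛ|^{−kₛ/(2π)}) · |z−z'| dt ≤ (2 / (1 − (Σₛ max(kₛ,0))/(2π))) · |z−z'|^{1 − (Σₛ max(kₛ,0))/(2π)}. (This is the bound of the segment-length proposition for a measure which is the finite sum Σₛ kₛ δ_{pₛ} of Dirac masses, for which exp(V[ω](w)) = ∏ₛ |w − pₛ|^{−kₛ/(2π)}.) -/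
open Metric Real

open MeasureTheory in
/-- The singular integral `∫₀¹ |t - c|^(-a) dt` converges and is at most `2 / (1 - a)`. -/
lemma integral_abs_sub_rpow_neg_le {a c : ℝ} (ha1 : a < 1) (hc0 : 0 ≤ c)
    (hc1 : c ≤ 1) :
    IntervalIntegrable (fun t : ℝ => |t - c| ^ (-a)) volume 0 1 ∧
      ∫ t in (0:ℝ)..1, |t - c| ^ (-a) ≤ 2 / (1 - a) := by
  have hr : ∀ x y : ℝ, IntervalIntegrable (fun x : ℝ => x ^ (-a)) volume x y := fun x y =>
    intervalIntegral.intervalIntegrable_rpow' (by linarith)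
  have eqL : Set.EqOn (fun t : ℝ => (c - t) ^ (-a)) (fun t => |t - c| ^ (-a)) (Set.uIcc 0 c) := by
    intro t ht
    rw [Set.uIcc_of_le hc0] at ht
    simp only
    rw [abs_of_nonpos (by linarith [ht.2]), neg_sub]
  have eqR : Set.EqOn (fun t : ℝ => (t - c) ^ (-a)) (fun t => |t - c| ^ (-a)) (Set.uIcc c 1) := by
    intro t ht
    rw [Set.uIcc_of_le hc1] at ht
    simp only
    rw [abs_of_nonneg (by linarith [ht.1])]
  have hL : IntervalIntegrable (fun t : ℝ => |t - c| ^ (-a)) volume 0 c := by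
    have h := (hr c 0).comp_sub_left c
    simp only [sub_self, sub_zero] at h
    exact h.congr (eqL.mono Set.uIoc_subset_uIcc)
  have hR : IntervalIntegrable (fun t : ℝ => |t - c| ^ (-a)) volume c 1 := by
    have h := (hr 0 (1 - c)).comp_sub_right c
    simp only [zero_add, sub_add_cancel] at h
    exact h.congr (eqR.mono Set.uIoc_subset_uIcc)
  refine ⟨hL.trans hR, ?_⟩
  have key : ∀ x : ℝ, 0 ≤ x → x ≤ 1 → ∫ t in (0:ℝ)..x, t ^ (-a) ≤ 1 / (1 - a) := by
    intro x hx0 hx1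
    rw [integral_rpow (Or.inl (by linarith)), Real.zero_rpow (by linarith), sub_zero,
      show -a + 1 = 1 - a by ring]
    exact div_le_div_of_nonneg_right (Real.rpow_le_one hx0 hx1 (by linarith)) (by linarith)
  rw [← intervalIntegral.integral_add_adjacent_intervals hL hR,
    ← intervalIntegral.integral_congr eqL, ← intervalIntegral.integral_congr eqR,
    intervalIntegral.integral_comp_sub_left (fun t => t ^ (-a)),
    intervalIntegral.integral_comp_sub_right (fun t => t ^ (-a)), sub_self, sub_zero]
  calc _ ≤ 1 / (1 - a) + 1 / (1 - a) :=
        add_le_add (key c hc0 hc1) (key (1 - c) (by linarith) (by linarith))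
    _ = 2 / (1 - a) := by ring

/-- Some parameter `c ∈ [0, 1]` satisfies `‖z - z'‖ |t - c| ≤ ‖γ(t) - p‖` along the segment. -/
lemma exists_norm_mul_abs_sub_le_norm_segment_sub (z z' p : ℂ) :
    ∃ c : ℝ, 0 ≤ c ∧ c ≤ 1 ∧ ∀ t : ℝ, 0 ≤ t → t ≤ 1 →
      ‖z - z'‖ * |t - c| ≤ ‖((1 - t) • z + t • z') - p‖ := by
  rcases eq_or_ne z z' with rfl | hne
  · exact ⟨0, le_rfl, zero_le_one, fun t _ _ => by simp⟩
  have hd : 0 < ‖z - z'‖ := norm_pos_iff.2 (sub_ne_zero.2 hne)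
  obtain ⟨c₀, hc₀⟩ : ∃ c₀ : ℝ, ∀ t : ℝ,
      ‖z - z'‖ * |t - c₀| ≤ ‖((1 - t) • z + t • z') - p‖ := by
    refine ⟨inner ℝ (z' - z) (p - z) / ‖z - z'‖ ^ 2, fun t => ?_⟩
    have h := abs_real_inner_le_norm (z' - z) (((1 - t) • z + t • z') - p)
    have e : ((1 - t) • z + t • z') - p = t • (z' - z) - (p - z) := by
      module
    rw [norm_sub_rev z' z] at h
    refine le_of_mul_le_mul_left (le_trans (le_of_eq ?_) h) hd
    have e' : inner ℝ (z' - z) (t • (z' - z) - (p - z)) =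
        ‖z - z'‖ ^ 2 * (t - inner ℝ (z' - z) (p - z) / ‖z - z'‖ ^ 2) := by
      rw [inner_sub_right (z' - z) (t • (z' - z)), real_inner_smul_right,
        real_inner_self_eq_norm_sq, norm_sub_rev z' z]
      field_simp
    rw [e, e', abs_mul, abs_of_nonneg (sq_nonneg ‖z - z'‖)]
    ring
  refine ⟨max 0 (min 1 c₀), le_max_left _ _, max_le zero_le_one (min_le_left _ _),
    fun t ht0 ht1 => le_trans (mul_le_mul_of_nonneg_left ?_ hd.le) (hc₀ t)⟩
  have h : t = max 0 (min 1 t) := by rw [min_eq_right ht1, max_eq_right ht0]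
  calc |t - max 0 (min 1 c₀)| = |max 0 (min 1 t) - max 0 (min 1 c₀)| := by rw [← h]
    _ ≤ |min 1 t - min 1 c₀| := by
        simpa using abs_max_sub_max_le_max 0 (min 1 t) 0 (min 1 c₀)
    _ ≤ |t - c₀| := by simpa using abs_min_sub_min_le_max 1 t 1 c₀

/-- Weighted AM-GM for a product of negative powers. -/
lemma prod_rpow_neg_le_sum {ι : Type*} [Fintype ι] {u b : ι → ℝ} (hu : ∀ s, 0 ≤ u s)
    (hb : ∀ s, 0 ≤ b s) (hpos : 0 < ∑ s, b s) :
    ∏ s, u s ^ (-b s) ≤ ∑ s, b s / (∑ i, b i) * u s ^ (-∑ i, b i) := by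
  have h := Real.geom_mean_le_arith_mean_weighted Finset.univ (fun s => b s / ∑ i, b i)
    (fun s => u s ^ (-∑ i, b i)) (fun s _ => div_nonneg (hb s) hpos.le)
    (by rw [← Finset.sum_div, div_self hpos.ne']) (fun s _ => Real.rpow_nonneg (hu s) _)
  refine le_trans (le_of_eq (Finset.prod_congr rfl fun s _ => ?_)) h
  rw [← Real.rpow_mul (hu s)]
  congr 1
  field_simp

open MeasureTheory in
/-- Along a segment, a product of nonnegative singular weights of total order `∑ b < 1` has
integral at most `2 / (1 - ∑ b) * ‖z - z'‖ ^ (-∑ b)`; the weight is only required to be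
dominated by that product. -/
lemma integral_le_of_le_prod_rpow_neg {ι : Type*} [Fintype ι] (p : ι → ℂ) {b : ι → ℝ}
    (hb : ∀ s, 0 ≤ b s) (hb1 : ∑ s, b s < 1) {z z' : ℂ} (hne : z ≠ z') {f : ℝ → ℝ}
    (hf0 : ∀ t, 0 ≤ f t)
    (hf : ∀ t, 0 ≤ t → t ≤ 1 → f t ≤ ∏ s, ‖((1 - t) • z + t • z') - p s‖ ^ (-b s)) :
    ∫ t in (0:ℝ)..1, f t ≤ 2 / (1 - ∑ s, b s) * ‖z - z'‖ ^ (-∑ s, b s) := by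
  have hd : 0 < ‖z - z'‖ := norm_pos_iff.2 (sub_ne_zero.2 hne)
  have mono : ∀ g : ℝ → ℝ, IntervalIntegrable g volume 0 1 →
      (∀ᵐ t, 0 ≤ t → t ≤ 1 → f t ≤ g t) → ∫ t in (0:ℝ)..1, f t ≤ ∫ t in (0:ℝ)..1, g t := by
    intro g hg hfg
    rw [intervalIntegral.integral_of_le zero_le_one, intervalIntegral.integral_of_le zero_le_one]
    refine integral_mono_of_nonneg (Filter.Eventually.of_forall hf0) hg.1 ?_
    filter_upwards [ae_restrict_of_ae hfg, ae_restrict_mem measurableSet_Ioc] with t h ht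
    exact h ht.1.le ht.2
  set a := ∑ s, b s with ha
  have ha0 : 0 ≤ a := Finset.sum_nonneg fun s _ => hb s
  rcases ha0.eq_or_lt with h0 | hpos
  · have hz : ∀ s, b s = 0 := fun s =>
      (Finset.sum_eq_zero_iff_of_nonneg fun s _ => hb s).1 h0.symm s (Finset.mem_univ s)
    have h := mono (fun _ => 1) intervalIntegrable_const
      (Filter.Eventually.of_forall fun t h0 h1 => by simpa [hz] using hf t h0 h1)
    simp only [intervalIntegral.integral_const, sub_zero, smul_eq_mul, mul_one] at h
    rw [← h0]
    norm_num
    linarith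
  choose c hc0 hc1 hc using fun s => exists_norm_mul_abs_sub_le_norm_segment_sub z z' (p s)
  have hI := fun s => integral_abs_sub_rpow_neg_le hb1 (hc0 s) (hc1 s)
  have hInt : ∀ s ∈ Finset.univ, IntervalIntegrable
      (fun t : ℝ => b s / a * (‖z - z'‖ ^ (-a) * |t - c s| ^ (-a))) volume 0 1 :=
    fun s _ => ((hI s).1.const_mul _).const_mul _
  refine (mono (fun t => ∑ s, b s / a * (‖z - z'‖ ^ (-a) * |t - c s| ^ (-a)))
    (by simpa [Finset.sum_fn] using IntervalIntegrable.sum Finset.univ hInt) ?_).trans ?_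
  · have hne : ∀ᵐ t : ℝ, ∀ s, t ≠ c s := ae_all_iff.2 fun s => Measure.ae_ne volume (c s)
    filter_upwards [hne] with t ht h0 h1
    refine (hf t h0 h1).trans ((prod_rpow_neg_le_sum (fun s => norm_nonneg _) hb hpos).trans
      (Finset.sum_le_sum fun s _ => mul_le_mul_of_nonneg_left ?_ (div_nonneg (hb s) ha0)))
    rw [← Real.mul_rpow hd.le (abs_nonneg _)]
    exact Real.rpow_le_rpow_of_nonpos (mul_pos hd (abs_pos.2 (sub_ne_zero.2 (ht s))))
      (hc s t h0 h1) (by linarith)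
  · rw [intervalIntegral.integral_finsetSum hInt]
    simp only [intervalIntegral.integral_const_mul]
    calc _ ≤ ∑ s, b s / a * (‖z - z'‖ ^ (-a) * (2 / (1 - a))) :=
          Finset.sum_le_sum fun s _ => mul_le_mul_of_nonneg_left
            (mul_le_mul_of_nonneg_left (hI s).2 (Real.rpow_nonneg hd.le _))
            (div_nonneg (hb s) ha0)
      _ = 2 / (1 - a) * ‖z - z'‖ ^ (-a) := by
          rw [← Finset.sum_mul, ← Finset.sum_div, ← ha, div_self hpos.ne', one_mul, mul_comm]



/-- Segment-length bound for a finite sum of Dirac masses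
`ω = Σₛ kₛ δ_{pₛ}` (for which `exp(V[ω](w)) = ∏ₛ |w - pₛ|^{-kₛ/(2π)}`): if
`Σₛ max(kₛ,0) < 2π` and `z, z' ∈ D(1/2)`, then
`∫₀¹ (∏ₛ |γ(t) - pₛ|^{-kₛ/(2π)}) |z-z'| dt ≤
  (2/(1 - (Σₛ max(kₛ,0))/(2π))) · |z-z'|^{1 - (Σₛ max(kₛ,0))/(2π)}`
where `γ(t) = (1-t)z + tz'`. -/
theorem segment_length_bound_dirac (n : ℕ) (p : Fin n → ℂ) (k : Fin n → ℝ)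
    (hp : ∀ s, p s ∈ ball (0 : ℂ) (1/2))
    (hk : ∑ s, max (k s) 0 < 2 * π)
    (z z' : ℂ) (hz : z ∈ ball (0 : ℂ) (1/2)) (hz' : z' ∈ ball (0 : ℂ) (1/2)) :
    (∫ t in (0:ℝ)..1,
        (∏ s, ‖((1 - t) • z + t • z') - p s‖ ^ (-(k s) / (2 * π))) * ‖z - z'‖) ≤
      (2 / (1 - (∑ s, max (k s) 0) / (2 * π))) *
        ‖z - z'‖ ^ (1 - (∑ s, max (k s) 0) / (2 * π)) := by
  rcases eq_or_ne z z' with rfl | hne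
  · have h : 0 < 1 - (∑ s, max (k s) 0) / (2 * π) := by
      rw [sub_pos, div_lt_one (by positivity)]
      exact hk
    simp [Real.zero_rpow h.ne']
  have hd : 0 < ‖z - z'‖ := norm_pos_iff.2 (sub_ne_zero.2 hne)
  have hb1 : ∑ s, max (k s) 0 / (2 * π) < 1 := by
    rw [← Finset.sum_div, div_lt_one (by positivity)]
    exact hk
  have h := integral_le_of_le_prod_rpow_neg p (b := fun s => max (k s) 0 / (2 * π))
    (fun s => by positivity) hb1 hne
    (f := fun t => ∏ s, ‖((1 - t) • z + t • z') - p s‖ ^ (-(k s) / (2 * π)))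
    (fun t => by positivity) (fun t h0 h1 => ?_)
  · rw [← Finset.sum_div] at h
    rw [intervalIntegral.integral_mul_const, sub_eq_neg_add 1, Real.rpow_add_one hd.ne',
      ← mul_assoc, ← sub_eq_neg_add]
    exact mul_le_mul_of_nonneg_right h hd.le
  refine Finset.prod_le_prod (fun s _ => by positivity) fun s _ => ?_
  rcases le_total 0 (k s) with hks | hks
  · rw [max_eq_left hks, neg_div]
  have hγ : (1 - t) • z + t • z' ∈ ball (0 : ℂ) (1 / 2) :=
    convex_ball (0 : ℂ) (1 / 2) hz hz' (by linarith) h0 (by ring)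
  have hs := hp s
  rw [mem_ball_zero_iff] at hγ hs
  rw [max_eq_right hks, zero_div, neg_zero, Real.rpow_zero]
  refine Real.rpow_le_one (norm_nonneg _) ((norm_sub_le _ _).trans (by linarith)) ?_
  exact div_nonneg (by linarith) (by positivity)
end

section
/- Let M ∈ (−1, 0), let z, z' ∈ ℂ with z ≠ z', let p ∈ ℂ, and let γ(t) = (1−t)z + t z'. Then ∫₀¹ |γ(t) − p|^M dt ≤ |z − z'|^M / ((M+1)·2^M). -/
open Real

/-- A real power of exponent above `-1` of the distance to a point of `[0, 1]` is integrable
on `[0, 1]`, with an explicit integral. -/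
lemma integral_abs_sub_rpow {M c : ℝ} (hM : -1 < M) (hc : c ∈ Set.Icc (0 : ℝ) 1) :
    IntervalIntegrable (fun t : ℝ => |t - c| ^ M) MeasureTheory.volume 0 1 ∧
      ∫ t in (0 : ℝ)..1, |t - c| ^ M = (c ^ (M + 1) + (1 - c) ^ (M + 1)) / (M + 1) := by
  obtain ⟨h0, h1⟩ := hc
  have hne : M + 1 ≠ 0 := by linarith
  have e1 : Set.EqOn (fun t : ℝ => (c - t) ^ M) (fun t : ℝ => |t - c| ^ M) (Set.uIcc 0 c) := by
    intro t ht
    rw [Set.uIcc_of_le h0] at ht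
    simp only
    rw [abs_of_nonpos (by linarith [ht.2]), neg_sub]
  have e2 : Set.EqOn (fun t : ℝ => (t - c) ^ M) (fun t : ℝ => |t - c| ^ M) (Set.uIcc c 1) := by
    intro t ht
    rw [Set.uIcc_of_le h1] at ht
    simp only
    rw [abs_of_nonneg (by linarith [ht.1])]
  have i1 : IntervalIntegrable (fun t : ℝ => |t - c| ^ M) MeasureTheory.volume 0 c := by
    have h := (intervalIntegral.intervalIntegrable_rpow' (a := c) (b := 0) hM).comp_sub_left c
    simp only [sub_self, sub_zero] at h
    exact h.congr (e1.mono Set.uIoc_subset_uIcc)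
  have i2 : IntervalIntegrable (fun t : ℝ => |t - c| ^ M) MeasureTheory.volume c 1 := by
    have h := (intervalIntegral.intervalIntegrable_rpow' (a := 0) (b := 1 - c) hM).comp_sub_right c
    simp only [zero_add, sub_add_cancel] at h
    exact h.congr (e2.mono Set.uIoc_subset_uIcc)
  refine ⟨i1.trans i2, ?_⟩
  rw [← intervalIntegral.integral_add_adjacent_intervals i1 i2,
    ← intervalIntegral.integral_congr e1, ← intervalIntegral.integral_congr e2,
    intervalIntegral.integral_comp_sub_left (fun x : ℝ => x ^ M) c,
    intervalIntegral.integral_comp_sub_right (fun x : ℝ => x ^ M) c,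
    integral_rpow (Or.inl hM), integral_rpow (Or.inl hM)]
  simp only [sub_self, sub_zero, zero_rpow hne]
  ring

/-- By concavity, `c ^ (M + 1) + (1 - c) ^ (M + 1)` is largest at `c = 1 / 2`. -/
lemma rpow_add_one_sub_rpow_le {M c : ℝ} (hM : M ∈ Set.Ioo (-1 : ℝ) 0)
    (hc : c ∈ Set.Icc (0 : ℝ) 1) :
    c ^ (M + 1) + (1 - c) ^ (M + 1) ≤ 1 / 2 ^ M := by
  have h := (Real.concaveOn_rpow (p := M + 1) (by linarith [hM.1]) (by linarith [hM.2])).2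
    (Set.mem_Ici.2 hc.1) (Set.mem_Ici.2 (sub_nonneg.2 hc.2))
    (by norm_num : (0 : ℝ) ≤ 1 / 2) (by norm_num : (0 : ℝ) ≤ 1 / 2) (by norm_num)
  simp only [smul_eq_mul] at h
  rw [show 1 / 2 * c + 1 / 2 * (1 - c) = (1 / 2 : ℝ) by ring,
    rpow_add_one (by norm_num : (1 / 2 : ℝ) ≠ 0), div_rpow (by norm_num) (by norm_num),
    one_rpow] at h
  linarith

/-- Projecting a point of the line onto `[0, 1]` brings it closer to each point of `[0, 1]`. -/
lemma abs_sub_max_min_le {t : ℝ} (ht : t ∈ Set.Icc (0 : ℝ) 1) (c : ℝ) :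
    |t - max 0 (min c 1)| ≤ |t - c| := by
  have h := Set.abs_projIcc_sub_projIcc (zero_le_one' ℝ) (c := t) (d := c)
  rw [Set.projIcc_of_mem zero_le_one ht, Set.coe_projIcc, min_comm] at h
  exact h

/-- For `M ∈ (-1,0)`, `z ≠ z'` in `ℂ`, `p ∈ ℂ`, and
`γ(t) = (1-t)z + tz'`, one has `∫₀¹ |γ(t) - p|^M dt ≤ |z-z'|^M / ((M+1)·2^M)`. -/
theorem integral_segment_rpow_bound (M : ℝ) (hM : M ∈ Set.Ioo (-1 : ℝ) 0)
    (z z' : ℂ) (hzz : z ≠ z') (p : ℂ) :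
    (∫ t in (0:ℝ)..1, ‖((1 - t) • z + t • z') - p‖ ^ M) ≤
      ‖z - z'‖ ^ M / ((M + 1) * 2 ^ M) := by
  have hd : z - z' ≠ 0 := sub_ne_zero.2 hzz
  have hpos : 0 < M + 1 := by linarith [hM.1]
  set w : ℂ := (z - p) / (z - z') with hw
  set c : ℝ := max 0 (min w.re 1) with hc
  have hcI : c ∈ Set.Icc (0 : ℝ) 1 :=
    ⟨le_max_left _ _, max_le zero_le_one (min_le_right _ _)⟩
  obtain ⟨hint, hval⟩ := integral_abs_sub_rpow hM.1 hcI
  have hle : ∀ t ∈ Set.Icc (0 : ℝ) 1, t ≠ c →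
      ‖((1 - t) • z + t • z') - p‖ ^ M ≤ ‖z - z'‖ ^ M * |t - c| ^ M := by
    intro t ht htc
    have hfac : ((1 - t) • z + t • z') - p = (z - z') * (w - t) := by
      rw [hw, mul_sub, mul_div_cancel₀ _ hd]
      simp only [Complex.real_smul]
      push_cast
      ring
    have hre : |t - w.re| ≤ ‖w - t‖ := by
      rw [abs_sub_comm]
      simpa using Complex.abs_re_le_norm (w - t)
    rw [hfac, norm_mul, mul_rpow (norm_nonneg _) (norm_nonneg _)]
    gcongr ?_ * ?_
    exact rpow_le_rpow_of_nonpos (abs_pos.2 (sub_ne_zero.2 htc))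
      ((abs_sub_max_min_le ht _).trans hre) hM.2.le
  calc (∫ t in (0:ℝ)..1, ‖((1 - t) • z + t • z') - p‖ ^ M)
      ≤ ∫ t in (0:ℝ)..1, ‖z - z'‖ ^ M * |t - c| ^ M := by
        rw [intervalIntegral.integral_of_le zero_le_one,
          intervalIntegral.integral_of_le zero_le_one]
        refine MeasureTheory.integral_mono_of_nonneg
          (Filter.Eventually.of_forall fun t => by positivity)
          (hint.const_mul _).1 ?_
        filter_upwards [MeasureTheory.ae_restrict_mem measurableSet_Ioc,
          MeasureTheory.ae_restrict_of_ae (MeasureTheory.Measure.ae_ne MeasureTheory.volume c)]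
          with t ht htc
        exact hle t (Set.Ioc_subset_Icc_self ht) htc
    _ = ‖z - z'‖ ^ M * ((c ^ (M + 1) + (1 - c) ^ (M + 1)) / (M + 1)) := by
        rw [intervalIntegral.integral_const_mul, hval]
    _ ≤ ‖z - z'‖ ^ M * (1 / 2 ^ M / (M + 1)) := by
        gcongr
        exact rpow_add_one_sub_rpow_le hM hcI
    _ = ‖z - z'‖ ^ M / ((M + 1) * 2 ^ M) := by
        field_simp
end

section
/- (Troyanov) Let ν be a finite nonnegative Borel measure on ℂ supported in the closed disc D̄(1/2), and let p > 1 satisfy p · ν(ℂ) < 2π. Then ∫_{D(1/2)} exp(2p · V[ν](z)) dλ(z) ≤ π / (1 − (p/(2π)) · ν(ℂ)). -/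
open MeasureTheory Metric Real

/-- The logarithmic potential of a (nonnegative) measure on `ℂ`:
`V[ν](z) = ∫ (-1/(2π)) ln|z-ξ| dν(ξ)`. -/
noncomputable def potential (ν : Measure ℂ) (z : ℂ) : ℝ :=
  ∫ ξ, (-1 / (2 * π)) * Real.log ‖z - ξ‖ ∂ν

open Set in
theorem lintegral_exp_neg_log_norm {a : ℝ} (ha : a < 2) :
    ∫⁻ z : ℂ, ENNReal.ofReal
      ((Iio 1).indicator (fun y : ℝ => Real.exp (-(a * Real.log y))) ‖z‖) =
      ENNReal.ofReal (2 * π / (2 - a)) := by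
  set F : ℝ → ℝ := (Iio 1).indicator (fun y : ℝ => Real.exp (-(a * Real.log y))) with hF
  have hEq : ∀ y ∈ Ioi (0 : ℝ), y ^ (Module.finrank ℝ ℂ - 1) • F y =
      (Ioo 0 1).indicator (fun y : ℝ => y ^ (1 - a)) y := by
    intro y (hy : 0 < y)
    by_cases h1 : y < 1
    · have : y ^ (1 - a) = y * Real.exp (-(a * Real.log y)) := by
        rw [Real.rpow_sub hy, Real.rpow_one, Real.rpow_def_of_pos hy, Real.exp_neg,
          mul_comm a, div_eq_mul_inv]
      simp [hF, h1, hy, Complex.finrank_real_complex, this]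
    · simp [hF, h1]
  have hint : IntegrableOn (fun y : ℝ => y ^ (1 - a)) (Ioo 0 1) := by
    have := intervalIntegral.intervalIntegrable_rpow' (a := 0) (b := 1)
      (show -1 < 1 - a by linarith)
    rw [intervalIntegrable_iff_integrableOn_Ioo_of_le zero_le_one] at this
    exact this
  have hI : Integrable (fun z : ℂ => F ‖z‖) := by
    rw [integrable_fun_norm_addHaar volume (f := F),
      integrableOn_congr_fun hEq measurableSet_Ioi]
    exact ((integrable_indicator_iff measurableSet_Ioo).2 hint).integrableOn
  have hv : ∫ z : ℂ, F ‖z‖ = 2 * π / (2 - a) := by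
    rw [integral_fun_norm_addHaar volume F, setIntegral_congr_fun measurableSet_Ioi hEq,
      setIntegral_indicator measurableSet_Ioo,
      inter_eq_self_of_subset_right Ioo_subset_Ioi_self, ← integral_Ioc_eq_integral_Ioo,
      ← intervalIntegral.integral_of_le zero_le_one, integral_rpow (Or.inl (by linarith))]
    have h2 : 1 - a + 1 ≠ 0 := by linarith
    rw [Real.zero_rpow h2, Real.one_rpow]
    simp [Complex.finrank_real_complex, Measure.real, Complex.volume_ball]
    rw [show 1 - a + 1 = 2 - a by ring]
    ring
  rw [← hv, ofReal_integral_eq_lintegral_ofReal hI]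
  exact .of_forall fun z => indicator_nonneg (fun _ _ => (Real.exp_pos _).le) _

/-- Jensen's inequality for the exponential of an a.e. nonnegative function; no integrability is
required, as the Bochner integral of a non-integrable function is `0`. -/
theorem ofReal_exp_integral_le_lintegral {X : Type*} [MeasurableSpace X] (μ : Measure X)
    [IsProbabilityMeasure μ] {f : X → ℝ} (hf : 0 ≤ᵐ[μ] f) :
    ENNReal.ofReal (Real.exp (∫ x, f x ∂μ)) ≤ ∫⁻ x, ENNReal.ofReal (Real.exp (f x)) ∂μ := by
  by_cases hfi : Integrable f μ
  · set c := ∫ x, f x ∂μ with hc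
    have hle : ∀ x, Real.exp c * (1 + (f x - c)) ≤ Real.exp (f x) := fun x => by
      have h := mul_le_mul_of_nonneg_left (Real.add_one_le_exp (f x - c)) (Real.exp_pos c).le
      rw [← Real.exp_add, add_sub_cancel] at h
      linarith
    have hg : Integrable (fun x => Real.exp c * (1 + (f x - c))) μ :=
      ((integrable_const _).add (hfi.sub (integrable_const _))).const_mul _
    have hgi : ∫ x, Real.exp c * (1 + (f x - c)) ∂μ = Real.exp c := by
      rw [integral_const_mul,
        integral_add (g := fun x => f x - c) (integrable_const _) (hfi.sub (integrable_const _)),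
        integral_sub hfi (integrable_const _)]
      simp [← hc]
    by_cases he : Integrable (fun x => Real.exp (f x)) μ
    · rw [← ofReal_integral_eq_lintegral_ofReal he (.of_forall fun x => (Real.exp_pos _).le)]
      exact ENNReal.ofReal_le_ofReal (hgi ▸ integral_mono hg he hle)
    · have hm : AEStronglyMeasurable (fun x => Real.exp (f x)) μ :=
        Real.continuous_exp.comp_aestronglyMeasurable hfi.1
      have htop : ∫⁻ x, ENNReal.ofReal (Real.exp (f x)) ∂μ = ⊤ := by
        by_contra h
        exact he ((lintegral_ofReal_ne_top_iff_integrable hm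
          (.of_forall fun x => (Real.exp_pos _).le)).1 h)
      simp [htop]
  · rw [integral_undef hfi]
    calc ENNReal.ofReal (Real.exp 0) = ∫⁻ _, 1 ∂μ := by simp
      _ ≤ _ := by
        refine lintegral_mono_ae (hf.mono fun x hx => ?_)
        rw [← ENNReal.ofReal_one]
        exact ENNReal.ofReal_le_ofReal (Real.one_le_exp hx)

/-- **Troyanov.** If `ν` is a finite nonnegative measure supported in
`D̄(1/2)` and `p > 1` satisfies `p·ν(ℂ) < 2π`, then
`∫_{D(1/2)} exp(2p·V[ν](z)) dλ(z) ≤ π / (1 - (p/(2π))·ν(ℂ))`. -/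
theorem troyanov (ν : Measure ℂ) [IsFiniteMeasure ν]
    (hsupp : ν ((closedBall (0 : ℂ) (1/2))ᶜ) = 0)
    (p : ℝ) (hp : 1 < p) (hpν : p * (ν Set.univ).toReal < 2 * π) :
    (∫ z in ball (0 : ℂ) (1/2), Real.exp (2 * p * potential ν z)) ≤
      π / (1 - p / (2 * π) * (ν Set.univ).toReal) := by
  have hπ := Real.pi_pos
  rcases eq_or_ne ν 0 with rfl | hν
  · simp [potential, Measure.real, Complex.volume_ball]
    have : ((2 : ℝ) ^ 2)⁻¹ ≤ 1 := by norm_num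
    nlinarith
  have : NeZero ν := ⟨hν⟩
  set m := (ν Set.univ).toReal with hm
  have hm0 : 0 < m := ENNReal.toReal_pos (by simpa using hν) (measure_ne_top _ _)
  set a := p * m / π with ha
  have ha0 : 0 ≤ a := by positivity
  have ha2 : a < 2 := by rw [ha, div_lt_iff₀ hπ]; exact hpν
  set μ : Measure ℂ := (ν Set.univ)⁻¹ • ν with hμ
  have hRHS : π / (1 - p / (2 * π) * m) = 2 * π / (2 - a) := by
    have h1 : 1 - p / (2 * π) * m = (2 - a) / 2 := by rw [ha]; field_simp
    rw [h1]
    field_simp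
  have hpot : ∀ z, 2 * p * potential ν z = ∫ ξ, -(a * Real.log ‖z - ξ‖) ∂μ := fun z => by
    rw [hμ, integral_smul_measure, potential, ENNReal.toReal_inv, ← hm, smul_eq_mul,
      ← integral_const_mul, ← integral_const_mul]
    congr 1 with ξ
    rw [ha]
    field_simp
  have hsuppμ : ∀ᵐ ξ ∂μ, ξ ∈ closedBall (0 : ℂ) (1/2) := by
    rw [ae_iff]
    change μ ((closedBall (0 : ℂ) (1/2))ᶜ) = 0
    rw [hμ, Measure.smul_apply, hsupp, smul_zero]
  have hlt : ∀ z ∈ ball (0 : ℂ) (1/2), ∀ ξ ∈ closedBall (0 : ℂ) (1/2), ‖z - ξ‖ < 1 := by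
    intro z hz ξ hξ
    rw [mem_ball_zero_iff] at hz
    rw [mem_closedBall_zero_iff] at hξ
    linarith [norm_sub_le z ξ]
  have key : ∫⁻ z in ball (0 : ℂ) (1/2), ENNReal.ofReal (Real.exp (2 * p * potential ν z)) ≤
      ENNReal.ofReal (2 * π / (2 - a)) := by
    calc _ ≤ ∫⁻ z in ball (0 : ℂ) (1/2), ∫⁻ ξ,
          ENNReal.ofReal (Real.exp (-(a * Real.log ‖z - ξ‖))) ∂μ := by
          refine setLIntegral_mono' measurableSet_ball fun z hz => ?_
          rw [hpot]
          refine ofReal_exp_integral_le_lintegral μ (hsuppμ.mono fun ξ hξ => ?_)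
          have := Real.log_nonpos (norm_nonneg (z - ξ)) (hlt z hz ξ hξ).le
          simp only [Pi.zero_apply]
          nlinarith
      _ = ∫⁻ ξ, (∫⁻ z in ball (0 : ℂ) (1/2),
          ENNReal.ofReal (Real.exp (-(a * Real.log ‖z - ξ‖)))) ∂μ := by
          refine lintegral_lintegral_swap (Measurable.aemeasurable ?_)
          unfold Function.uncurry
          fun_prop
      _ ≤ ∫⁻ _, ENNReal.ofReal (2 * π / (2 - a)) ∂μ := by
          refine lintegral_mono_ae (hsuppμ.mono fun ξ hξ => ?_)
          rw [← lintegral_exp_neg_log_norm ha2, ← lintegral_sub_right_eq_self (μ := volume)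
            (fun z : ℂ => ENNReal.ofReal
              ((Set.Iio 1).indicator (fun y : ℝ => Real.exp (-(a * Real.log y))) ‖z‖)) ξ]
          refine le_trans (setLIntegral_mono' measurableSet_ball fun z hz => ?_)
            (setLIntegral_le_lintegral (ball (0 : ℂ) (1/2)) _)
          rw [Set.indicator_of_mem (Set.mem_Iio.2 (hlt z hz ξ hξ))]
      _ = _ := by simp
  rw [hRHS]
  refine (Real.le_norm_self _).trans ((norm_integral_le_lintegral_norm _).trans ?_)
  simp only [Real.norm_eq_abs, Real.abs_exp]
  exact ENNReal.toReal_le_of_le_ofReal (div_nonneg (by positivity) (by linarith)) key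
end

section
/- Let 0 < δ ≤ 2π and let ν be a finite nonnegative Borel measure on ℂ supported in the closed disc D̄(1/2) with ν(ℂ) ≤ 2π − δ. Set p := 4π/(4π − δ). Then p > 1, p · ν(ℂ) < 2π, and ∫_{D(1/2)} exp(2p · V[ν](z)) dλ(z) ≤ 4π²/δ. -/
open MeasureTheory Metric Real

/-- Jensen's inequality for the exponential of a nonnegative function against a finite measure,
with both sides allowed to be infinite. -/
theorem ofReal_exp_integral_le {α : Type*} [MeasurableSpace α] (ν : Measure α)
    [IsFiniteMeasure ν] (hν : ν ≠ 0) {f : α → ℝ} (hf : Measurable f) (hf0 : ∀ᵐ x ∂ν, 0 ≤ f x) :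
    ENNReal.ofReal (Real.exp (∫ x, f x ∂ν)) ≤
      (ν Set.univ)⁻¹ * ∫⁻ x, ENNReal.ofReal (Real.exp (ν.real Set.univ * f x)) ∂ν := by
  have : NeZero ν := ⟨hν⟩
  set M := ν.real Set.univ with hM
  have hM0 : 0 < M := by
    rw [hM, measureReal_def]
    exact ENNReal.toReal_pos (by simpa using hν) (measure_ne_top _ _)
  have hνM : ν Set.univ = ENNReal.ofReal M := by
    rw [hM, measureReal_def, ENNReal.ofReal_toReal (measure_ne_top _ _)]
  by_cases hint : Integrable (fun x ↦ Real.exp (M * f x)) ν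
  · have hfi : Integrable (fun x ↦ M * f x) ν := by
      refine hint.mono (hf.const_mul M).aestronglyMeasurable ?_
      filter_upwards [hf0] with x hx
      rw [Real.norm_of_nonneg (by positivity), Real.norm_of_nonneg (by positivity)]
      linarith [Real.add_one_le_exp (M * f x)]
    have key := convexOn_exp.map_average_le Real.continuous_exp.continuousOn isClosed_univ
      (by simp) hfi hint
    rw [average_eq, average_eq, ← hM, integral_const_mul, smul_eq_mul, smul_eq_mul,
      inv_mul_cancel_left₀ hM0.ne'] at key
    calc _ ≤ ENNReal.ofReal (M⁻¹ * ∫ x, Real.exp (M * f x) ∂ν) := ENNReal.ofReal_le_ofReal key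
      _ = _ := by
        rw [ENNReal.ofReal_mul (by positivity), ofReal_integral_eq_lintegral_ofReal hint
          (ae_of_all _ fun _ ↦ (Real.exp_pos _).le), hνM, ENNReal.ofReal_inv_of_pos hM0]
  · have htop : ∫⁻ x, ENNReal.ofReal (Real.exp (M * f x)) ∂ν = ⊤ := by
      by_contra h
      refine hint ⟨(hf.const_mul M).exp.aestronglyMeasurable, ?_⟩
      rw [hasFiniteIntegral_iff_ofReal (ae_of_all _ fun _ ↦ (Real.exp_pos _).le)]
      exact lt_top_iff_ne_top.2 h
    rw [htop, ENNReal.mul_top (ENNReal.inv_ne_zero.2 (measure_ne_top _ _))]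
    exact le_top

theorem lintegral_Ioo_ofReal_rpow {s : ℝ} (hs : -1 < s) :
    ∫⁻ r in Set.Ioo (0 : ℝ) 1, ENNReal.ofReal (r ^ s) = ENNReal.ofReal (1 / (s + 1)) := by
  rw [← ofReal_integral_eq_lintegral_ofReal
    ((intervalIntegral.integrableOn_Ioo_rpow_iff one_pos).2 hs)
    (ae_restrict_of_forall_mem measurableSet_Ioo fun r hr ↦ Real.rpow_nonneg hr.1.le _),
    ← integral_Ioc_eq_integral_Ioo, ← intervalIntegral.integral_of_le zero_le_one,
    integral_rpow (Or.inl hs), Real.one_rpow, Real.zero_rpow (by linarith), sub_zero]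

/-- The integral of `‖z‖ ^ (-a)` over the unit disc, for `a < 2`. -/
theorem lintegral_ball_exp_neg_mul_log_norm_le {a : ℝ} (ha : a < 2) :
    ∫⁻ z in ball (0 : ℂ) 1, ENNReal.ofReal (Real.exp (-a * Real.log ‖z‖)) ≤
      ENNReal.ofReal (2 * π / (2 - a)) := by
  have hs : -1 < 1 - a := by linarith
  set h : ℝ → ENNReal := (Set.Ioo (0 : ℝ) 1).indicator fun r ↦ ENNReal.ofReal (r ^ (1 - a)) with hh
  have hmeas : Measurable h :=
    (ENNReal.measurable_ofReal.comp (measurable_id.pow_const _)).indicator measurableSet_Ioo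
  rw [← lintegral_indicator measurableSet_ball, ← Complex.lintegral_comp_polarCoord_symm]
  calc _ = ∫⁻ p in polarCoord.target, h p.1 := by
        refine setLIntegral_congr_fun polarCoord.open_target.measurableSet fun p hp ↦ ?_
        have hp0 : 0 < p.1 := hp.1
        have hn : ‖Complex.polarCoord.symm p‖ = p.1 := by
          rw [Complex.norm_polarCoord_symm, abs_of_pos hp0]
        by_cases hp1 : p.1 < 1
        · have h1 : Complex.polarCoord.symm p ∈ ball (0 : ℂ) 1 := by
            rwa [mem_ball_zero_iff, hn]
          have h2 : p.1 ∈ Set.Ioo (0 : ℝ) 1 := ⟨hp0, hp1⟩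
          simp only [hh, Set.indicator_of_mem h1, Set.indicator_of_mem h2, hn, smul_eq_mul]
          rw [← ENNReal.ofReal_mul hp0.le, sub_eq_add_neg, Real.rpow_add hp0, Real.rpow_one,
            Real.rpow_def_of_pos hp0, mul_comm (-a)]
        · have h1 : Complex.polarCoord.symm p ∉ ball (0 : ℂ) 1 := by
            rwa [mem_ball_zero_iff, hn]
          have h2 : p.1 ∉ Set.Ioo (0 : ℝ) 1 := fun h ↦ hp1 h.2
          simp only [hh, Set.indicator_of_notMem h1, Set.indicator_of_notMem h2, smul_zero]
    _ = (∫⁻ r in Set.Ioi (0 : ℝ), h r) * ENNReal.ofReal (2 * π) := by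
        rw [polarCoord_target, Measure.volume_eq_prod, ← Measure.prod_restrict,
          lintegral_prod (fun p : ℝ × ℝ ↦ h p.1) (hmeas.comp measurable_fst).aemeasurable]
        simp only [lintegral_const, Measure.restrict_apply_univ, Real.volume_Ioo]
        rw [lintegral_mul_const _ hmeas]
        ring_nf
    _ ≤ (∫⁻ r, h r) * ENNReal.ofReal (2 * π) := by
        exact mul_le_mul_left (setLIntegral_le_lintegral _ _) _
    _ = _ := by
        rw [hh, lintegral_indicator measurableSet_Ioo, lintegral_Ioo_ofReal_rpow hs,
          ← ENNReal.ofReal_mul (by apply one_div_nonneg.2; linarith)]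
        congr 1
        rw [show 1 - a + 1 = 2 - a by ring]
        ring

theorem lintegral_ball_half_exp_neg_mul_log_norm_sub_le {a : ℝ} (ha : a < 2) {ξ : ℂ}
    (hξ : ξ ∈ closedBall (0 : ℂ) (1 / 2)) :
    ∫⁻ z in ball (0 : ℂ) (1 / 2), ENNReal.ofReal (Real.exp (-a * Real.log ‖z - ξ‖)) ≤
      ENNReal.ofReal (2 * π / (2 - a)) := by
  rw [mem_closedBall_zero_iff] at hξ
  calc _ ≤ ∫⁻ z, (ball (0 : ℂ) 1).indicator
        (fun w ↦ ENNReal.ofReal (Real.exp (-a * Real.log ‖w‖))) (z - ξ) := by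
        rw [← lintegral_indicator measurableSet_ball]
        refine lintegral_mono fun z ↦ ?_
        by_cases hz : z ∈ ball (0 : ℂ) (1 / 2)
        · have hmem : z - ξ ∈ ball (0 : ℂ) 1 := by
            rw [mem_ball_zero_iff] at hz ⊢
            linarith [norm_sub_le z ξ]
          rw [Set.indicator_of_mem hz, Set.indicator_of_mem hmem]
        · rw [Set.indicator_of_notMem hz]
          exact bot_le
    _ ≤ _ := by
        rw [lintegral_sub_right_eq_self, lintegral_indicator measurableSet_ball]
        exact lintegral_ball_exp_neg_mul_log_norm_le ha

/-- Exponential integrability of the logarithmic potential of a nonzero measure supported in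
the closed disc of radius `1 / 2`. -/
theorem lintegral_exp_potential_le {ν : Measure ℂ} [IsFiniteMeasure ν] (hν : ν ≠ 0)
    (hsupp : ν ((closedBall (0 : ℂ) (1 / 2))ᶜ) = 0) {p : ℝ} (hp : 0 ≤ p)
    (hpν : p * ν.real Set.univ < 2 * π) :
    ∫⁻ z in ball (0 : ℂ) (1 / 2), ENNReal.ofReal (Real.exp (2 * p * potential ν z)) ≤
      ENNReal.ofReal (2 * π / (2 - p * ν.real Set.univ / π)) := by
  set M := ν.real Set.univ with hM
  set a := p * M / π with ha
  have ha2 : a < 2 := by rwa [ha, div_lt_iff₀ pi_pos]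
  have hsupp' : ∀ᵐ ξ ∂ν, ξ ∈ closedBall (0 : ℂ) (1 / 2) := hsupp
  have hmeas : Measurable fun q : ℂ × ℂ ↦
      ENNReal.ofReal (Real.exp (-a * Real.log ‖q.1 - q.2‖)) := by fun_prop
  calc _ ≤ ∫⁻ z in ball (0 : ℂ) (1 / 2), (ν Set.univ)⁻¹ *
        ∫⁻ ξ, ENNReal.ofReal (Real.exp (-a * Real.log ‖z - ξ‖)) ∂ν := by
        refine setLIntegral_mono' measurableSet_ball fun z hz ↦ ?_
        have hJ := ofReal_exp_integral_le ν hν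
          (f := fun ξ ↦ 2 * p * ((-1 / (2 * π)) * Real.log ‖z - ξ‖)) (by fun_prop) (by
            filter_upwards [hsupp'] with ξ hξ
            rw [mem_closedBall_zero_iff] at hξ
            rw [mem_ball_zero_iff] at hz
            have hlog : Real.log ‖z - ξ‖ ≤ 0 :=
              Real.log_nonpos (norm_nonneg _) (by linarith [norm_sub_le z ξ])
            have : -1 / (2 * π) ≤ 0 :=
              div_nonpos_of_nonpos_of_nonneg (by norm_num) (by positivity)
            exact mul_nonneg (by positivity) (mul_nonneg_of_nonpos_of_nonpos this hlog))
        rw [integral_const_mul, ← hM] at hJ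
        refine hJ.trans_eq ?_
        congr! 5 with ξ
        rw [ha]
        field_simp
    _ = (ν Set.univ)⁻¹ * ∫⁻ ξ, (∫⁻ z in ball (0 : ℂ) (1 / 2),
        ENNReal.ofReal (Real.exp (-a * Real.log ‖z - ξ‖))) ∂ν := by
        rw [lintegral_const_mul _ hmeas.lintegral_prod_right',
          lintegral_lintegral_swap hmeas.aemeasurable]
    _ ≤ (ν Set.univ)⁻¹ * ∫⁻ _, ENNReal.ofReal (2 * π / (2 - a)) ∂ν := by
        refine mul_le_mul_right (lintegral_mono_ae ?_) _
        filter_upwards [hsupp'] with ξ hξ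
        exact lintegral_ball_half_exp_neg_mul_log_norm_sub_le ha2 hξ
    _ = _ := by
        rw [lintegral_const, mul_comm (ENNReal.ofReal _), ← mul_assoc,
          ENNReal.inv_mul_cancel (by simpa using hν) (measure_ne_top _ _), one_mul]

/-- Let `0 < δ ≤ 2π` and let `ν` be a finite nonnegative measure
supported in `D̄(1/2)` with `ν(ℂ) ≤ 2π - δ`.  With `p := 4π/(4π - δ)` one has `p > 1`,
`p·ν(ℂ) < 2π`, and `∫_{D(1/2)} exp(2p·V[ν](z)) dλ(z) ≤ 4π²/δ`. -/
theorem troyanov_application (δ : ℝ) (hδ : 0 < δ) (hδ' : δ ≤ 2 * π)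
    (ν : Measure ℂ) [IsFiniteMeasure ν]
    (hsupp : ν ((closedBall (0 : ℂ) (1/2))ᶜ) = 0)
    (hν : (ν Set.univ).toReal ≤ 2 * π - δ) :
    1 < 4 * π / (4 * π - δ) ∧
    (4 * π / (4 * π - δ)) * (ν Set.univ).toReal < 2 * π ∧
    (∫ z in ball (0 : ℂ) (1/2),
        Real.exp (2 * (4 * π / (4 * π - δ)) * potential ν z)) ≤ 4 * π ^ 2 / δ := by
  have hπ := pi_pos
  have hd : 0 < 4 * π - δ := by linarith
  have hp : 1 < 4 * π / (4 * π - δ) := by rw [lt_div_iff₀ hd]; linarith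
  have hpν : 4 * π / (4 * π - δ) * (ν Set.univ).toReal ≤
      4 * π * (2 * π - δ) / (4 * π - δ) := by
    rw [mul_div_right_comm (4 * π)]
    exact mul_le_mul_of_nonneg_left hν (zero_le_one.trans hp.le)
  have hlt : 4 * π / (4 * π - δ) * (ν Set.univ).toReal < 2 * π := by
    refine hpν.trans_lt ?_
    rw [div_lt_iff₀ hd]
    nlinarith
  refine ⟨hp, hlt, ?_⟩
  rcases eq_or_ne ν 0 with rfl | hν0
  · simp only [potential, integral_zero_measure, mul_zero, Real.exp_zero, integral_const,
      smul_eq_mul, mul_one, measureReal_def]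
    rw [le_div_iff₀ hδ]
    simp
    nlinarith
  · have hL := lintegral_exp_potential_le hν0 hsupp (zero_le_one.trans hp.le) hlt
    rw [measureReal_def] at hL
    have hpos : 2 * δ / (4 * π - δ) ≤
        2 - 4 * π / (4 * π - δ) * (ν Set.univ).toReal / π := by
      have := div_le_div_of_nonneg_right hpν hπ.le
      have h2 : 4 * π * (2 * π - δ) / (4 * π - δ) / π = 2 - 2 * δ / (4 * π - δ) := by
        field_simp
        ring
      linarith
    have hpos0 : 0 < 2 * δ / (4 * π - δ) := by positivity
    refine (Real.le_norm_self _).trans ((norm_integral_le_lintegral_norm _).trans ?_)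
    simp only [Real.norm_of_nonneg (Real.exp_pos _).le]
    refine (ENNReal.toReal_le_of_le_ofReal (div_nonneg (by positivity) (hpos0.le.trans hpos)) hL).trans ?_
    calc _ ≤ 2 * π / (2 * δ / (4 * π - δ)) := by gcongr
      _ = π * (4 * π - δ) / δ := by field_simp
      _ ≤ _ := by
        refine div_le_div_of_nonneg_right ?_ hδ.le
        nlinarith
end

section
/- Let Σ be a topological surface (a topological 2-manifold without boundary) endowed with a metric d that induces its topology, let x ∈ Σ and r > 0. Assume that for every s' with 0 < s' < r, the closed ball B̄(x,s') = {y ∈ Σ : d(x,y) ≤ s'} is homeomorphic to the closed unit disc in ℝ². Then for every s with 0 < s < r, the open ball B(x,s) = {y ∈ Σ : d(x,y) < s} is homeomorphic to the open unit disc in ℝ². -/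
open Metric

/-- A continuous map on the closed unit disc of `ℂ` that is at distance less than `1` from the
identity on the unit circle has a zero. -/
theorem Complex.exists_eq_zero_of_norm_sub_lt_one {h : ℂ → ℂ}
    (hc : ContinuousOn h (closedBall 0 1)) (hb : ∀ z, ‖z‖ = 1 → ‖h z - z‖ < 1) :
    ∃ z ∈ closedBall (0 : ℂ) 1, h z = 0 := by
  by_contra! h0
  set p : ℂ → ℂ := fun z => ((max 1 ‖z‖)⁻¹ : ℝ) • z with hp
  have hpos : ∀ z : ℂ, 0 < max 1 ‖z‖ := fun z => lt_max_of_lt_left one_pos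
  have hpc : Continuous p :=
    ((continuous_const.max continuous_norm).inv₀ fun z => (hpos z).ne').smul continuous_id
  have hpm : ∀ z, p z ∈ closedBall (0 : ℂ) 1 := fun z => by
    rw [mem_closedBall_zero_iff, hp]
    simp only [norm_smul, norm_inv, Real.norm_eq_abs, abs_of_pos (hpos z)]
    exact (inv_mul_le_one₀ (hpos z)).2 (le_max_right _ _)
  have hp1 : ∀ z : ℂ, ‖z‖ = 1 → p z = z := fun z hz => by simp [hp, hz]
  obtain ⟨L, ⟨-, hL⟩, -⟩ := Complex.isCoveringMapOn_exp.existsUnique_continuousMap_lifts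
    (⟨fun z => h (p z), hc.comp_continuous hpc hpm⟩ : C(ℂ, ℂ)) (a₀ := 0)
    (Complex.exp_log (h0 _ (hpm 0))) (fun z => h0 _ (hpm z))
  have hL' : ∀ z, Complex.exp (L z) = h (p z) := fun z => congrFun hL z
  set e : ℝ → ℂ := fun t => Complex.exp (t * Complex.I) with he
  have hec : Continuous e := by fun_prop
  have hen : ∀ t, ‖e t‖ = 1 := fun t => Complex.norm_exp_ofReal_mul_I t
  have he0 : ∀ t, e t ≠ 0 := fun t => Complex.exp_ne_zero _
  have hem : ∀ t, e t ∈ closedBall (0 : ℂ) 1 := fun t => by simp [hen]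
  have hslit : ∀ t, h (e t) / e t ∈ Complex.slitPlane := fun t => by
    refine Complex.ball_one_subset_slitPlane ?_
    rw [mem_ball, dist_eq_norm, div_sub_one (he0 t), norm_div, hen, div_one]
    exact hb _ (hen t)
  set N : ℝ → ℂ := fun t => L (e t) - Complex.log (h (e t) / e t) with hN
  have hNc : Continuous N :=
    (L.continuous.comp hec).sub
      (((hc.comp_continuous hec hem).div hec he0).clog hslit)
  have hNe : ∀ t, Complex.exp (N t) = e t := fun t => by
    have h1 := h0 _ (hem t)
    have h2 := he0 t
    simp only [hN, Complex.exp_sub]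
    rw [hL', hp1 _ (hen t), Complex.exp_log (div_ne_zero h1 h2)]
    field_simp
  have hNe0 : Complex.exp (N 0) = 1 := by rw [hNe]; simp [he]
  have key : N = fun t : ℝ => N 0 + t * Complex.I :=
    Complex.isCoveringMap_exp.eq_of_comp_eq hNc (by fun_prop)
      (by
        funext t
        apply Subtype.ext
        simp only [Function.comp_apply]
        rw [hNe, Complex.exp_add, hNe0, one_mul]) 0 (by simp)
  have h2 := congrFun key (2 * Real.pi)
  have h3 : e (2 * Real.pi) = e 0 := by simp [he]
  have h4 : N (2 * Real.pi) = N 0 := by simp only [hN, h3]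
  rw [h4] at h2
  simp [Real.pi_ne_zero] at h2

/-- An injective continuous map of the closed unit disc to the plane maps the center of the disc
to an interior point of its image. -/
theorem Complex.apply_zero_mem_interior_image_closedBall {f : ℂ → ℂ}
    (hc : ContinuousOn f (closedBall 0 1)) (hi : Set.InjOn f (closedBall 0 1)) :
    f 0 ∈ interior (f '' closedBall 0 1) := by
  by_contra hint
  have hD : IsCompact (closedBall (0 : ℂ) 1) := isCompact_closedBall 0 1
  have h0D : (0 : ℂ) ∈ closedBall (0 : ℂ) 1 := by simp
  have hK := hD.image_of_continuousOn hc
  have : CompactSpace (closedBall (0 : ℂ) 1) := isCompact_iff_compactSpace.1 hD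
  obtain ⟨G, hG⟩ : ∃ G : C(ℂ, ℂ), ∀ z ∈ closedBall (0 : ℂ) 1, G (f z) = z := by
    have hcl : Topology.IsClosedEmbedding ((closedBall (0 : ℂ) 1).domRestrict f) :=
      (continuousOn_iff_continuous_domRestrict.1 hc).isClosedEmbedding
        (Set.injOn_iff_injective.1 hi)
    obtain ⟨G, hG⟩ := ContinuousMap.exists_extension hcl
      (⟨Subtype.val, continuous_subtype_val⟩ : C(closedBall (0 : ℂ) 1, ℂ))
    exact ⟨G, fun z hz => DFunLike.congr_fun hG ⟨z, hz⟩⟩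
  have hsD : sphere (0 : ℂ) 1 ⊆ closedBall 0 1 := sphere_subset_closedBall
  have hS : IsCompact (f '' sphere 0 1) :=
    (isCompact_sphere 0 1).image_of_continuousOn (hc.mono hsD)
  have hyS : f 0 ∈ (f '' sphere 0 1)ᶜ := by
    rintro ⟨z, hz, hfz⟩
    rw [hi (hsD hz) h0D hfz] at hz
    simp at hz
  obtain ⟨η, hη, hηS⟩ := Metric.isOpen_iff.1 hS.isClosed.isOpen_compl _ hyS
  obtain ⟨ε, hε, rfl⟩ : ∃ ε > 0, η = 2 * ε := ⟨η / 2, half_pos hη, by ring⟩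
  obtain ⟨c, hcε, hcK⟩ : ∃ c ∈ ball (f 0) ε, c ∉ f '' closedBall 0 1 := by
    by_contra! hsub
    exact hint (mem_interior_iff_mem_nhds.2 (Filter.mem_of_superset (ball_mem_nhds _ hε) hsub))
  have hsph : ∀ z ∈ sphere (0 : ℂ) 1, ε ≤ ‖f z - c‖ := fun z hz => by
    by_contra! hlt
    refine hηS ?_ ⟨z, hz, rfl⟩
    have := dist_triangle (f z) c (f 0)
    rw [dist_eq_norm (f z) c] at this
    rw [mem_ball] at hcε ⊢
    linarith
  have hA : IsCompact (f '' closedBall 0 1 \ ball c ε) := hK.diff isOpen_ball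
  have hGA : ∀ y ∈ f '' closedBall 0 1 \ ball c ε, 0 < ‖G y‖ := by
    rintro _ ⟨⟨z, hz, rfl⟩, hy⟩
    rw [hG z hz, norm_pos_iff]
    rintro rfl
    rw [mem_ball_comm] at hcε
    exact hy hcε
  obtain ⟨δ, hδ, hδ1, hδA⟩ : ∃ δ > 0, δ ≤ 1 ∧ ∀ y ∈ f '' closedBall 0 1 \ ball c ε, δ ≤ ‖G y‖ := by
    obtain ⟨δ, hδ, hδA⟩ := hA.exists_forall_le' (G.continuous.norm.continuousOn) hGA
    exact ⟨min δ 1, lt_min hδ one_pos, min_le_right _ _,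
      fun y hy => (min_le_left _ _).trans (hδA y hy)⟩
  obtain ⟨P, hP, hPG, -⟩ := G.continuous.exists_contDiff_approx (ε := fun _ => δ / 2) 1
    continuous_const (fun _ => half_pos hδ)
  obtain ⟨w, hw, hwP⟩ : ∃ w ∈ ball (0 : ℂ) (δ / 2), w ∉ P '' sphere c ε := by
    by_contra! hsub
    have h0 : MeasureTheory.volume (P '' sphere c ε) = 0 :=
      MeasureTheory.addHaar_image_eq_zero_of_differentiableOn_of_addHaar_eq_zero
        MeasureTheory.volume (hP.differentiable one_ne_zero).differentiableOn
        (MeasureTheory.Measure.addHaar_sphere_of_ne_zero _ _ hε.ne')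
    exact (measure_ball_pos MeasureTheory.volume (0 : ℂ) (half_pos hδ)).ne'
      (MeasureTheory.measure_mono_null hsub h0)
  have hfc : ∀ z ∈ closedBall (0 : ℂ) 1, ‖f z - c‖ ≠ 0 := fun z hz h =>
    hcK ⟨z, hz, sub_eq_zero.1 (norm_eq_zero.1 h)⟩
  set Φ : ℂ → ℂ := fun z => c + (max 1 (ε / ‖f z - c‖) : ℝ) • (f z - c) with hΦ
  have hΦc : ContinuousOn Φ (closedBall 0 1) := by
    have h1 : ContinuousOn (fun z => f z - c) (closedBall 0 1) := hc.sub continuousOn_const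
    exact continuousOn_const.add
      ((continuousOn_const.sup (continuousOn_const.div h1.norm hfc)).smul h1)
  have hΦ1 : ∀ z ∈ closedBall (0 : ℂ) 1, ε ≤ ‖f z - c‖ → Φ z = f z := fun z hz hle => by
    have : ε / ‖f z - c‖ ≤ 1 := div_le_one_of_le₀ hle (norm_nonneg _)
    simp [hΦ, max_eq_left this]
  have hclose : ∀ y, ‖P y - w - G y‖ < δ := fun y => by
    have h1 := hPG y
    rw [dist_eq_norm] at h1
    rw [mem_ball_zero_iff] at hw
    calc ‖P y - w - G y‖ = ‖(P y - G y) - w‖ := by congr 1; ring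
      _ ≤ ‖P y - G y‖ + ‖w‖ := norm_sub_le _ _
      _ < δ := by linarith
  obtain ⟨z, hz, hz0⟩ := Complex.exists_eq_zero_of_norm_sub_lt_one (h := fun z => P (Φ z) - w)
    ((hP.continuous.comp_continuousOn hΦc).sub continuousOn_const) (fun z hz => by
      have hzs : z ∈ sphere (0 : ℂ) 1 := by simpa using hz
      have h1 := hclose (f z)
      rw [hG z (hsD hzs)] at h1
      simp only [hΦ1 z (hsD hzs) (hsph z hzs)]
      exact h1.trans_le hδ1)
  rcases le_or_gt ε ‖f z - c‖ with hle | hlt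
  · have h1 := hclose (f z)
    rw [hΦ1 z hz hle] at hz0
    rw [hz0, zero_sub, norm_neg] at h1
    refine absurd h1 (not_lt.2 (hδA _ ⟨⟨z, hz, rfl⟩, ?_⟩))
    rw [mem_ball, dist_eq_norm]
    exact not_lt.2 hle
  · refine hwP ⟨Φ z, ?_, sub_eq_zero.1 hz0⟩
    have hpos : 0 < ‖f z - c‖ := (norm_nonneg _).lt_of_ne' (hfc z hz)
    have h1 : 1 ≤ ε / ‖f z - c‖ := (one_le_div hpos).2 hlt.le
    simp only [hΦ, mem_sphere, dist_eq_norm, add_sub_cancel_left, max_eq_right h1, norm_smul,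
      Real.norm_eq_abs, abs_of_pos (div_pos hε hpos)]
    field_simp

/-- **Invariance of domain** in the complex plane. -/
theorem Complex.isOpen_image_of_injOn {f : ℂ → ℂ} {U : Set ℂ} (hU : IsOpen U)
    (hc : ContinuousOn f U) (hi : Set.InjOn f U) : IsOpen (f '' U) := by
  rw [isOpen_iff_mem_nhds]
  rintro _ ⟨z, hz, rfl⟩
  obtain ⟨ρ, hρ, hρU⟩ := Metric.nhds_basis_closedBall.mem_iff.1 (hU.mem_nhds hz)
  have hm : Set.MapsTo (fun v : ℂ => z + ρ * v) (closedBall 0 1) U := fun v hv => by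
    refine hρU ?_
    rw [mem_closedBall_zero_iff] at hv
    simp only [mem_closedBall, dist_eq_norm, add_sub_cancel_left, norm_mul, Complex.norm_real,
      Real.norm_eq_abs, abs_of_pos hρ]
    exact mul_le_of_le_one_right hρ.le hv
  have hinj : Function.Injective (fun v : ℂ => z + ρ * v) := fun v w hvw => by
    simpa [hρ.ne'] using hvw
  have key := Complex.apply_zero_mem_interior_image_closedBall
    (hc.comp (by fun_prop : ContinuousOn (fun v : ℂ => z + ρ * v) (closedBall 0 1)) hm)
    (hi.comp hinj.injOn hm)
  rw [mem_interior_iff_mem_nhds] at key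
  simp only [Function.comp_apply, mul_zero, add_zero] at key
  refine Filter.mem_of_superset key ?_
  rintro _ ⟨v, hv, rfl⟩
  exact ⟨_, hm hv, rfl⟩

/-- **Invariance of domain** in the Euclidean plane. -/
theorem EuclideanSpace.isOpen_image_of_injOn
    {f : EuclideanSpace ℝ (Fin 2) → EuclideanSpace ℝ (Fin 2)}
    {U : Set (EuclideanSpace ℝ (Fin 2))} (hU : IsOpen U)
    (hc : ContinuousOn f U) (hi : Set.InjOn f U) : IsOpen (f '' U) := by
  let φ : ℂ ≃ₜ EuclideanSpace ℝ (Fin 2) := Complex.orthonormalBasisOneI.repr.toHomeomorph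
  have key := Complex.isOpen_image_of_injOn (f := φ.symm ∘ f ∘ φ) (hU.preimage φ.continuous)
    (φ.symm.continuous.comp_continuousOn
      (hc.comp φ.continuous.continuousOn (Set.mapsTo_preimage φ U)))
    (φ.symm.injective.comp_injOn (hi.comp φ.injective.injOn (Set.mapsTo_preimage φ U)))
  rw [Set.image_comp, φ.symm.isOpen_image, Set.image_comp,
    Set.image_preimage_eq U φ.surjective] at key
  exact key

/-- **Invariance of domain** for topological surfaces. -/
theorem ChartedSpace.isOpen_image_of_injOn {S T : Type*} [TopologicalSpace S] [TopologicalSpace T]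
    [ChartedSpace (EuclideanSpace ℝ (Fin 2)) S] [ChartedSpace (EuclideanSpace ℝ (Fin 2)) T]
    {f : S → T} {U : Set S} (hU : IsOpen U) (hc : ContinuousOn f U) (hi : Set.InjOn f U) :
    IsOpen (f '' U) := by
  rw [isOpen_iff_mem_nhds]
  rintro _ ⟨y, hy, rfl⟩
  set e := chartAt (EuclideanSpace ℝ (Fin 2)) y
  set e' := chartAt (EuclideanSpace ℝ (Fin 2)) (f y)
  set V : Set S := (U ∩ f ⁻¹' e'.source) ∩ e.source
  have hV : IsOpen V := (hc.isOpen_inter_preimage hU e'.open_source).inter e.open_source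
  have hyV : y ∈ V := ⟨⟨hy, mem_chart_source _ _⟩, mem_chart_source _ _⟩
  have hm : Set.MapsTo e.symm (e '' V) V := by
    rintro _ ⟨v, hv, rfl⟩
    rwa [e.left_inv hv.2]
  have hfm : Set.MapsTo f V e'.source := fun v hv => hv.1.2
  have heV : IsOpen (e '' V) := e.isOpen_image_of_subset_source hV Set.inter_subset_right
  have heT : e '' V ⊆ e.target := by
    rintro _ ⟨v, hv, rfl⟩
    exact e.map_source hv.2
  have key := EuclideanSpace.isOpen_image_of_injOn (f := e' ∘ f ∘ e.symm) heV
    (e'.continuousOn.comp ((hc.mono fun v hv => hv.1.1).comp (e.continuousOn_symm.mono heT) hm)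
      (hfm.comp hm))
    (e'.injOn.comp ((hi.mono fun v hv => hv.1.1).comp (e.symm.injOn.mono heT) hm) (hfm.comp hm))
  have himg : (e' ∘ f ∘ e.symm) '' (e '' V) = e' '' (f '' V) := by
    rw [Set.image_comp, Set.image_comp, (e.leftInvOn.mono Set.inter_subset_right).image_image]
  rw [himg] at key
  have hfV : IsOpen (f '' V) := by
    have := e'.isOpen_image_symm_of_subset_target key (by
      rintro _ ⟨_, ⟨v, hv, rfl⟩, rfl⟩
      exact e'.map_source (hfm hv))
    rwa [(e'.leftInvOn.mono hfm.image_subset).image_image] at this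
  exact Filter.mem_of_superset (hfV.mem_nhds ⟨y, hyV, rfl⟩)
    (Set.image_mono fun v hv => hv.1.1)

/-- An increasing homeomorphism of `ℝ` that is the identity outside `[a, c]` and maps
`b` to `b'`, where both points lie in that interval. -/
theorem Real.exists_orderIso_eq_self_off_Icc {a b b' c : ℝ} (hab : a < b) (hbb : b ≤ b')
    (hbc : b' < c) :
    ∃ τ : ℝ ≃o ℝ, (∀ t ≤ a, τ t = t) ∧ (∀ t, c ≤ t → τ t = t) ∧ τ b = b' := by
  set m : ℝ := (b' - a) / (b - a) with hm
  set n : ℝ := (c - b') / (c - b) with hn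
  have hb1 : 0 < b - a := by linarith
  have hb2 : 0 < c - b := by linarith
  have hm1 : 1 ≤ m := (one_le_div hb1).2 (by linarith)
  have hn0 : 0 < n := div_pos (by linarith) hb2
  have hn1 : n ≤ 1 := div_le_one_of_le₀ (by linarith) hb2.le
  have hmb : m * (b - a) = b' - a := div_mul_cancel₀ _ hb1.ne'
  have hnb : n * (c - b) = c - b' := div_mul_cancel₀ _ hb2.ne'
  set τ : ℝ → ℝ := fun t => max t (min (a + m * (t - a)) (c - n * (c - t))) with hτ
  have hmono : StrictMono τ := fun s t hst =>
    max_lt_max hst (min_lt_min (by nlinarith) (by nlinarith))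
  have hcont : Continuous τ := by fun_prop
  have hlow : ∀ t ≤ a, τ t = t := fun t ht =>
    max_eq_left ((min_le_left _ _).trans (by nlinarith))
  have hhigh : ∀ t, c ≤ t → τ t = t := fun t ht =>
    max_eq_left ((min_le_right _ _).trans (by nlinarith))
  have hsurj : Function.Surjective τ := hcont.surjective
    (Filter.tendsto_atTop_mono (fun t => le_max_left _ _) Filter.tendsto_id)
    (Filter.tendsto_id.congr' ((Filter.eventually_le_atBot a).mono fun t ht => (hlow t ht).symm))
  refine ⟨hmono.orderIsoOfSurjective τ hsurj, hlow, hhigh, ?_⟩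
  change τ b = b'
  simp only [hτ, hmb, hnb]
  rw [show a + (b' - a) = b' by ring, show c - (c - b') = b' by ring, min_self, max_eq_right hbb]

/-- A radial homeomorphism of a normed space that is the identity on the closed ball of radius `a`
and outside the open ball of radius `c`, and maps the closed ball of radius `b` onto the closed
ball of radius `b'`. -/
theorem exists_homeomorph_norm_le_iff (E : Type*) [NormedAddCommGroup E] [NormedSpace ℝ E]
    {a b b' c : ℝ} (ha : 0 < a) (hab : a < b) (hbb : b ≤ b') (hbc : b' < c) :
    ∃ φ : E ≃ₜ E, (∀ x, ‖x‖ ≤ a → φ x = x) ∧ (∀ x, c ≤ ‖x‖ → φ x = x) ∧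
      ∀ x, ‖φ x‖ ≤ b' ↔ ‖x‖ ≤ b := by
  obtain ⟨τ, hlow, hhigh, hb⟩ := Real.exists_orderIso_eq_self_off_Icc hab hbb hbc
  let ρ : (ℝ ≃o ℝ) → E → E := fun σ x => (σ ‖x‖ / ‖x‖) • x
  have hρ0 : ∀ (σ : ℝ ≃o ℝ) (x : E), σ ‖x‖ = ‖x‖ → ρ σ x = x := fun σ x h => by
    rcases eq_or_ne x 0 with rfl | hx
    · simp [ρ]
    · simp [ρ, h, div_self (norm_ne_zero_iff.2 hx)]
  have hnorm : ∀ σ : ℝ ≃o ℝ, (∀ t ≤ a, σ t = t) → ∀ x, ‖ρ σ x‖ = σ ‖x‖ := fun σ hσ x => by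
    have h0 : 0 ≤ σ ‖x‖ := by
      rw [← hσ 0 ha.le]
      exact σ.monotone (norm_nonneg x)
    rcases eq_or_ne x 0 with rfl | hx
    · simp [ρ, hσ 0 ha.le]
    · simp only [ρ, norm_smul, norm_div, norm_norm, Real.norm_of_nonneg h0]
      exact div_mul_cancel₀ _ (norm_ne_zero_iff.2 hx)
  have hcont : ∀ σ : ℝ ≃o ℝ, (∀ t ≤ a, σ t = t) → Continuous (ρ σ) := fun σ hσ => by
    rw [continuous_iff_continuousAt]
    intro x
    rcases eq_or_ne x 0 with rfl | hx
    · refine continuousAt_id.congr ?_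
      filter_upwards [closedBall_mem_nhds (0 : E) ha] with y hy
      exact (hρ0 σ y (hσ _ (mem_closedBall_zero_iff.1 hy))).symm
    · exact (((σ.continuous.comp continuous_norm).continuousAt.div continuous_norm.continuousAt
        (norm_ne_zero_iff.2 hx)).smul continuousAt_id)
  have hinv : ∀ σ : ℝ ≃o ℝ, (∀ t ≤ a, σ t = t) → ∀ x, ρ σ.symm (ρ σ x) = x := fun σ hσ x => by
    rcases eq_or_ne x 0 with rfl | hx
    · simp [ρ]
    · have hx' : 0 < ‖x‖ := norm_pos_iff.2 hx
      have h0 : 0 < σ ‖x‖ := by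
        rw [← hσ 0 ha.le]
        exact σ.strictMono hx'
      change (σ.symm ‖ρ σ x‖ / ‖ρ σ x‖) • ρ σ x = x
      rw [hnorm σ hσ, σ.symm_apply_apply]
      simp only [ρ, smul_smul]
      rw [div_mul_div_cancel₀ h0.ne', div_self hx'.ne', one_smul]
  have hlow' : ∀ t ≤ a, τ.symm t = t := fun t ht => by
    rw [τ.symm_apply_eq, hlow t ht]
  refine ⟨⟨⟨ρ τ, ρ τ.symm, hinv τ hlow, hinv τ.symm hlow'⟩, hcont τ hlow, hcont τ.symm hlow'⟩,
    fun x hx => hρ0 τ x (hlow _ hx), fun x hx => hρ0 τ x (hhigh _ hx), fun x => ?_⟩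
  change ‖ρ τ x‖ ≤ b' ↔ _
  rw [hnorm τ hlow, ← hb, τ.le_iff_le]

/-- A homeomorphism of `X` with support in a compact set `Q` extends along an open embedding of `X`
in a Hausdorff space `M` to a homeomorphism of `M` supported in the image of `Q`. -/
theorem Topology.IsOpenEmbedding.exists_homeomorph_extension {X M : Type*} [TopologicalSpace X]
    [TopologicalSpace M] [T2Space M] {f : X → M} (hf : IsOpenEmbedding f) (φ : X ≃ₜ X) {Q : Set X}
    (hQ : IsCompact Q) (hφ : ∀ x ∉ Q, φ x = x) :
    ∃ Φ : M ≃ₜ M, (∀ x, Φ (f x) = f (φ x)) ∧ ∀ y ∉ f '' Q, Φ y = y := by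
  have key : ∀ φ : X ≃ₜ X, (∀ x ∉ Q, φ x = x) →
      ∃ F : M → M, Continuous F ∧ (∀ x, F (f x) = f (φ x)) ∧ ∀ y ∉ f '' Q, F y = y := by
    intro φ hφ
    set F : M → M := Function.extend f (f ∘ φ) id with hF
    have h1 : ∀ x, F (f x) = f (φ x) := fun x => hf.injective.extend_apply _ _ _
    have h2 : ∀ y ∉ f '' Q, F y = y := fun y hy => by
      by_cases h : ∃ x, f x = y
      · obtain ⟨x, rfl⟩ := h
        rw [h1, hφ x fun hx => hy ⟨x, hx, rfl⟩]
      · exact Function.extend_apply' _ _ _ h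
    refine ⟨F, continuous_iff_continuousAt.2 fun y => ?_, h1, h2⟩
    by_cases hy : y ∈ f '' Q
    · obtain ⟨x, -, rfl⟩ := hy
      rw [← hf.continuousAt_iff, show F ∘ f = f ∘ φ from funext h1]
      exact (hf.continuous.comp φ.continuous).continuousAt
    · refine continuousAt_id.congr ?_
      filter_upwards [(hQ.image hf.continuous).isClosed.isOpen_compl.mem_nhds hy] with z hz
      exact (h2 z hz).symm
  have hφ' : ∀ x ∉ Q, φ.symm x = x := fun x hx => by
    rw [φ.symm_apply_eq, hφ x hx]
  obtain ⟨F, hFc, hF1, hF2⟩ := key φ hφ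
  obtain ⟨F', hFc', hF1', hF2'⟩ := key φ.symm hφ'
  refine ⟨⟨⟨F, F', fun y => ?_, fun y => ?_⟩, hFc, hFc'⟩, hF1, hF2⟩
  · by_cases hy : y ∈ f '' Q
    · obtain ⟨x, -, rfl⟩ := hy
      rw [hF1, hF1', φ.symm_apply_apply]
    · rw [hF2 y hy, hF2' y hy]
  · by_cases hy : y ∈ f '' Q
    · obtain ⟨x, -, rfl⟩ := hy
      rw [hF1', hF1, φ.apply_symm_apply]
    · rw [hF2' y hy, hF2 y hy]

section MonotoneUnion

variable {E M : Type*} [NormedAddCommGroup E] [NormedSpace ℝ E] [ProperSpace E]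
  [TopologicalSpace M] [T2Space M]

/-- If every compact subset of `M` lies in an open cell, then an open cell in `M` can be modified
outside a given ball so as to engulf a given compact set. -/
theorem Topology.IsOpenEmbedding.exists_eqOn_closedBall_of_isCompact
    (hM : ∀ C : Set M, IsCompact C → ∃ f : E → M, IsOpenEmbedding f ∧ C ⊆ Set.range f)
    {g : E → M} (hg : IsOpenEmbedding g) {R : ℝ} (hR : 0 < R) {C : Set M} (hC : IsCompact C) :
    ∃ g' : E → M, IsOpenEmbedding g' ∧ Set.EqOn g' g (closedBall 0 R) ∧
      C ⊆ g' '' closedBall 0 (R + 1) := by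
  have hB : IsCompact (C ∪ g '' closedBall 0 (R + 1)) :=
    hC.union ((isCompact_closedBall _ _).image hg.continuous)
  obtain ⟨f, hf, hBf, hf0⟩ : ∃ f : E → M, IsOpenEmbedding f ∧
      C ∪ g '' closedBall 0 (R + 1) ⊆ Set.range f ∧ f 0 = g 0 := by
    obtain ⟨f, hf, hBf⟩ := hM _ hB
    obtain ⟨p, hp⟩ : g 0 ∈ Set.range f :=
      hBf (Or.inr ⟨0, by simpa using by linarith, rfl⟩)
    refine ⟨f ∘ Homeomorph.addRight p, hf.comp (Homeomorph.addRight p).isOpenEmbedding, ?_, ?_⟩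
    · rwa [(Homeomorph.addRight p).surjective.range_comp]
    · simpa using hp
  obtain ⟨T, hT, hBT⟩ : ∃ T > 0, f ⁻¹' (C ∪ g '' closedBall 0 (R + 1)) ⊆ closedBall 0 T := by
    obtain ⟨T, hT⟩ := ((hf.isInducing.isCompact_preimage_iff hBf).2 hB).isBounded.subset_closedBall 0
    exact ⟨max T 1, lt_max_of_lt_right one_pos,
      hT.trans (closedBall_subset_closedBall (le_max_left _ _))⟩
  have small : ∀ {u v : E → M}, IsOpenEmbedding u → IsOpenEmbedding v → u 0 = v 0 →
      ∀ {A B : ℝ}, 0 < A → 0 < B → ∃ b > 0, b ≤ A ∧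
        ∀ x, ‖x‖ ≤ b → ∃ y, ‖y‖ < B ∧ v y = u x := by
    intro u v hu hv huv A B hA hB
    have hn : u ⁻¹' (v '' ball 0 B) ∈ nhds (0 : E) :=
      (((hv.isOpenMap _ isOpen_ball).preimage hu.continuous)).mem_nhds
        ⟨0, mem_ball_self hB, huv.symm⟩
    obtain ⟨b, hb, hbs⟩ := Metric.nhds_basis_closedBall.mem_iff.1 hn
    refine ⟨min b A, lt_min hb hA, min_le_right _ _, fun x hx => ?_⟩
    obtain ⟨y, hy, hyx⟩ := hbs (mem_closedBall_zero_iff.2 (hx.trans (min_le_left _ _)))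
    exact ⟨y, mem_ball_zero_iff.1 hy, hyx⟩
  have supp : ∀ {φ : E ≃ₜ E} {c : ℝ}, (∀ x, c ≤ ‖x‖ → φ x = x) →
      ∀ x ∉ closedBall (0 : E) c, φ x = x := fun h x hx =>
    h x (not_le.1 (mt mem_closedBall_zero_iff.2 hx)).le
  obtain ⟨b, hb, hbT, hbg⟩ := small hf hg hf0 hT (by linarith : 0 < R + 1)
  obtain ⟨φ, hφ1, hφ2, hφ3⟩ :=
    exists_homeomorph_norm_le_iff E (half_pos hb) (half_lt_self hb) hbT (lt_add_one T)
  obtain ⟨Φ, hΦ1, -⟩ := hf.exists_homeomorph_extension φ (isCompact_closedBall 0 (T + 1)) (supp hφ2)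
  obtain ⟨η, hη, hηR, hηf⟩ := small hg hf hf0.symm hR (half_pos hb)
  obtain ⟨ψ, hψ1, hψ2, hψ3⟩ :=
    exists_homeomorph_norm_le_iff E (half_pos hη) (half_lt_self hη) hηR (lt_add_one R)
  obtain ⟨Ψ, hΨ1, hΨ2⟩ :=
    hg.exists_homeomorph_extension ψ (isCompact_closedBall 0 (R + 1)) (supp hψ2)
  refine ⟨fun x => Ψ (Φ (Ψ.symm (g x))),
    Ψ.isOpenEmbedding.comp (Φ.isOpenEmbedding.comp (Ψ.symm.isOpenEmbedding.comp hg)),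
    fun x hx => ?_, fun y hy => ?_⟩
  · have h1 : Ψ.symm (g x) = g (ψ.symm x) := by
      rw [Ψ.symm_apply_eq, hΨ1, ψ.apply_symm_apply]
    have h2 : ‖ψ.symm x‖ ≤ η := by
      rw [← hψ3, ψ.apply_symm_apply]
      exact mem_closedBall_zero_iff.1 hx
    obtain ⟨z, hz, hzx⟩ := hηf _ h2
    have h3 : Φ (g (ψ.symm x)) = g (ψ.symm x) := by
      rw [← hzx, hΦ1, hφ1 z hz.le]
    change Ψ (Φ (Ψ.symm (g x))) = g x
    rw [h1, h3, hΨ1, ψ.apply_symm_apply]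
  · have h1 : Ψ.symm y ∈ C ∪ g '' closedBall 0 (R + 1) := by
      by_contra hn
      have h := hΨ2 (Ψ.symm y) fun h => hn (Or.inr h)
      rw [Ψ.apply_symm_apply] at h
      exact hn (Or.inl (h ▸ hy))
    obtain ⟨z, hz⟩ := hBf h1
    have hzT : ‖z‖ ≤ T := mem_closedBall_zero_iff.1 (hBT (by rwa [Set.mem_preimage, hz]))
    have h2 : ‖φ.symm z‖ ≤ b := by rwa [← hφ3, φ.apply_symm_apply]
    obtain ⟨w, hw, hwz⟩ := hbg _ h2
    refine ⟨ψ w, ?_, ?_⟩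
    · rw [mem_closedBall_zero_iff]
      by_contra! hlt
      have := ψ.injective (hψ2 _ hlt.le)
      rw [this] at hlt
      exact lt_asymm hlt hw
    · have h3 : Ψ.symm (g (ψ w)) = g w := by rw [Ψ.symm_apply_eq, hΨ1]
      change Ψ (Φ (Ψ.symm (g (ψ w)))) = y
      rw [h3, hwz, hΦ1, φ.apply_symm_apply, hz, Ψ.apply_symm_apply]

/-- **Brown's theorem** on monotone unions of open cells: a σ-compact Hausdorff space in which every
compact set is contained in an open subset homeomorphic to the normed space `E` is homeomorphic
to `E`. -/
theorem nonempty_homeomorph_of_forall_isCompact_subset_range [SigmaCompactSpace M]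
    (hM : ∀ C : Set M, IsCompact C →
      ∃ f : E → M, Topology.IsOpenEmbedding f ∧ C ⊆ Set.range f) :
    Nonempty (E ≃ₜ M) := by
  obtain ⟨f₀, hf₀, -⟩ := hM ∅ isCompact_empty
  have step : ∀ (n : ℕ) (g : {g : E → M // Topology.IsOpenEmbedding g}),
      ∃ g' : {g : E → M // Topology.IsOpenEmbedding g},
        Set.EqOn g'.1 g.1 (closedBall 0 (n + 1)) ∧
          compactCovering M n ⊆ g'.1 '' closedBall 0 (n + 1 + 1) := fun n g => by
    obtain ⟨g', hg', h⟩ := g.2.exists_eqOn_closedBall_of_isCompact hM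
      (Nat.cast_add_one_pos n : (0 : ℝ) < n + 1) (isCompact_compactCovering M n)
    exact ⟨⟨g', hg'⟩, h⟩
  choose next hnext hcover using step
  let g : ℕ → {g : E → M // Topology.IsOpenEmbedding g} := fun n => Nat.rec ⟨f₀, hf₀⟩ next n
  have hstab : ∀ (n k : ℕ) (x : E), ‖x‖ ≤ n + 1 → (g (n + k)).1 x = (g n).1 x := by
    intro n k x hx
    induction k with
    | zero => rfl
    | succ k ih =>
      rw [← ih]
      refine hnext (n + k) (g (n + k)) (mem_closedBall_zero_iff.2 (hx.trans ?_))
      push_cast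
      linarith [(Nat.cast_nonneg k : (0 : ℝ) ≤ k)]
  let G : E → M := fun x => (g ⌈‖x‖⌉₊).1 x
  have hG : ∀ (n : ℕ) (x : E), ‖x‖ ≤ n + 1 → G x = (g n).1 x := by
    intro n x hx
    have hx' : ‖x‖ ≤ (⌈‖x‖⌉₊ : ℝ) + 1 := (Nat.le_ceil _).trans (by linarith)
    rcases le_total n ⌈‖x‖⌉₊ with h | h
    · obtain ⟨k, hk⟩ := Nat.exists_eq_add_of_le h
      simp only [G]
      rw [hk, hstab n k x hx]
    · obtain ⟨k, hk⟩ := Nat.exists_eq_add_of_le h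
      conv_rhs => rw [hk]
      exact (hstab _ k x hx').symm
  have hloc : ∀ x, ∃ n, G =ᶠ[nhds x] (g n).1 := fun x => by
    obtain ⟨n, hn⟩ := exists_nat_gt ‖x‖
    refine ⟨n, ?_⟩
    filter_upwards [(isOpen_lt continuous_norm continuous_const).mem_nhds hn] with y hy
    exact hG n y (le_of_lt (lt_trans hy (lt_add_one _)))
  have hcont : Continuous G := continuous_iff_continuousAt.2 fun x => by
    obtain ⟨n, hn⟩ := hloc x
    exact (g n).2.continuous.continuousAt.congr hn.symm
  have hopen : IsOpenMap G := isOpenMap_iff_nhds_le.2 fun x => by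
    obtain ⟨n, hn⟩ := hloc x
    rw [Filter.map_congr hn, hn.eq_of_nhds]
    exact (g n).2.isOpenMap.nhds_le x
  have hinj : Function.Injective G := fun x y hxy => by
    obtain ⟨n, hn⟩ := exists_nat_gt (max ‖x‖ ‖y‖)
    rw [hG n x (by linarith [le_max_left ‖x‖ ‖y‖]),
      hG n y (by linarith [le_max_right ‖x‖ ‖y‖])] at hxy
    exact (g n).2.injective hxy
  have hsurj : Function.Surjective G := fun y => by
    obtain ⟨n, hn⟩ := exists_mem_compactCovering y
    obtain ⟨x, hx, hxy⟩ := hcover n (g n) hn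
    refine ⟨x, ?_⟩
    rw [hG (n + 1) x (by push_cast; exact mem_closedBall_zero_iff.1 hx)]
    exact hxy
  exact ⟨(Equiv.ofBijective G ⟨hinj, hsurj⟩).toHomeomorphOfContinuousOpen hcont hopen⟩

end MonotoneUnion

/-- In a metric surface, the metric ball of radius `t` is contained in an open disc contained in the
closed metric ball of radius `t`, if the latter is homeomorphic to a closed disc. -/
theorem exists_isOpenEmbedding_ball_subset_range {S : Type*} [MetricSpace S]
    [ChartedSpace (EuclideanSpace ℝ (Fin 2)) S] {x : S} {t : ℝ}
    (h : closedBall x t ≃ₜ closedBall (0 : EuclideanSpace ℝ (Fin 2)) 1) :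
    ∃ u : EuclideanSpace ℝ (Fin 2) → S, Topology.IsOpenEmbedding u ∧ ball x t ⊆ Set.range u ∧
      Set.range u ⊆ closedBall x t := by
  let k : ball x t → EuclideanSpace ℝ (Fin 2) :=
    fun y => h (Set.inclusion ball_subset_closedBall y)
  have hk : Continuous k :=
    continuous_subtype_val.comp (h.continuous.comp (continuous_inclusion _))
  have hki : Function.Injective k :=
    Subtype.val_injective.comp (h.injective.comp (Set.inclusion_injective _))
  let l : ball (0 : EuclideanSpace ℝ (Fin 2)) 1 → S :=
    fun z => h.symm (Set.inclusion ball_subset_closedBall z)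
  have hl : Continuous l :=
    continuous_subtype_val.comp (h.symm.continuous.comp (continuous_inclusion _))
  have hli : Function.Injective l :=
    Subtype.val_injective.comp (h.symm.injective.comp (Set.inclusion_injective _))
  let U : TopologicalSpace.Opens S := ⟨ball x t, isOpen_ball⟩
  have hko : IsOpen (Set.range k) := by
    rw [← Set.image_univ]
    exact ChartedSpace.isOpen_image_of_injOn (S := U) (f := k) isOpen_univ hk.continuousOn
      hki.injOn
  have hkb : Set.range k ⊆ ball 0 1 := by
    rw [← interior_closedBall (0 : EuclideanSpace ℝ (Fin 2)) one_ne_zero]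
    refine interior_maximal ?_ hko
    rintro _ ⟨y, rfl⟩
    exact (h _).2
  let u : EuclideanSpace ℝ (Fin 2) → S := l ∘ Homeomorph.unitBall
  have hu : Continuous u := hl.comp Homeomorph.unitBall.continuous
  have hui : Function.Injective u := hli.comp Homeomorph.unitBall.injective
  refine ⟨u, .of_continuous_injective_isOpenMap hu hui fun V hV =>
    ChartedSpace.isOpen_image_of_injOn hV hu.continuousOn hui.injOn, fun y hy => ?_, ?_⟩
  · refine ⟨Homeomorph.unitBall.symm ⟨k ⟨y, hy⟩, hkb ⟨_, rfl⟩⟩, ?_⟩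
    simp only [u, l, k, Function.comp_apply, Homeomorph.apply_symm_apply]
    exact congrArg Subtype.val (h.symm_apply_apply _)
  · rintro _ ⟨z, rfl⟩
    exact (h.symm _).2

/-- Let `S` be a topological surface (a 2-dimensional topological
manifold without boundary, formalized as a charted space over `ℝ²`) endowed with a
metric inducing its topology, `x ∈ S` and `r > 0`.  If for every `0 < s' < r` the
closed ball `B̄(x,s')` is homeomorphic to the closed unit disc of `ℝ²`, then for every
`0 < s < r` the open ball `B(x,s)` is homeomorphic to the open unit disc of `ℝ²`. -/
theorem open_ball_homeomorph_disc {S : Type*} [MetricSpace S]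
    [ChartedSpace (EuclideanSpace ℝ (Fin 2)) S]
    (x : S) (r : ℝ) (hr : 0 < r)
    (H : ∀ s' : ℝ, 0 < s' → s' < r →
      Nonempty ((closedBall x s') ≃ₜ (closedBall (0 : EuclideanSpace ℝ (Fin 2)) 1))) :
    ∀ s : ℝ, 0 < s → s < r →
      Nonempty ((ball x s) ≃ₜ (ball (0 : EuclideanSpace ℝ (Fin 2)) 1)) := by
  intro s hs hsr
  have hcompact : ∀ t, 0 < t → t < s → IsCompact (closedBall x t) := fun t ht hts => by
    obtain ⟨h⟩ := H t ht (hts.trans hsr)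
    exact isCompact_iff_compactSpace.2 h.symm.compactSpace
  have hsub : ∀ t < s, closedBall x t ⊆ Set.range (Subtype.val : ball x s → S) := fun t hts => by
    rw [Subtype.range_coe]
    exact closedBall_subset_ball hts
  have : SigmaCompactSpace (ball x s) := by
    obtain ⟨t, -, htm, ht⟩ := exists_seq_strictMono_tendsto' hs
    refine ⟨⟨fun n => Subtype.val ⁻¹' closedBall x (t n), fun n =>
      (Topology.IsInducing.subtypeVal.isCompact_preimage_iff (hsub _ (htm n).2)).2
        (hcompact _ (htm n).1 (htm n).2), Set.eq_univ_of_forall fun y => ?_⟩⟩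
    obtain ⟨n, hn⟩ := (ht.eventually_const_lt y.2).exists
    exact Set.mem_iUnion.2 ⟨n, mem_closedBall.2 hn.le⟩
  obtain ⟨e⟩ : Nonempty (EuclideanSpace ℝ (Fin 2) ≃ₜ ball x s) := by
    refine nonempty_homeomorph_of_forall_isCompact_subset_range fun C hC => ?_
    obtain ⟨t, ht, hts, hCt⟩ : ∃ t, 0 < t ∧ t < s ∧ ∀ y ∈ C, dist (y : S) x < t := by
      obtain ⟨m, hms, hm⟩ := hC.exists_forall_le' (f := fun y : ball x s => -dist (y : S) x) (a := -s)
        (by fun_prop) fun y _ => neg_lt_neg y.2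
      obtain ⟨t, htm, hts⟩ := exists_between (max_lt hs (neg_lt.1 hms))
      exact ⟨t, (le_max_left _ _).trans_lt htm, hts, fun y hy =>
        (le_neg_of_le_neg (hm y hy)).trans_lt ((le_max_right _ _).trans_lt htm)⟩
    obtain ⟨h⟩ := H t ht (hts.trans hsr)
    obtain ⟨u, hu, hball, hrange⟩ := exists_isOpenEmbedding_ball_subset_range h
    have hus : ∀ z, u z ∈ ball x s := fun z => closedBall_subset_ball hts (hrange ⟨z, rfl⟩)
    refine ⟨Set.codRestrict u _ hus, ?_, fun y hy => ?_⟩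
    · exact (Topology.IsOpenEmbedding.of_comp_iff _ isOpen_ball.isOpenEmbedding_subtypeVal).1 hu
    · obtain ⟨z, hz⟩ := hball (mem_ball.2 (hCt y hy))
      exact ⟨z, Subtype.ext hz⟩
  exact ⟨e.symm.trans Homeomorph.unitBall⟩
end

section
/- Let X be a compact topological space. For each m ∈ ℕ let d_m : X × X → ℝ be a metric on X (symmetric, satisfying the triangle inequality, and vanishing exactly on the diagonal) inducing the topology of X, and let d : X × X → ℝ be another such metric inducing the topology of X; assume d_m → d uniformly on X × X. Let x, y ∈ X and for each m let γ_m : [0,1] → X satisfy γ_m(0) = x, γ_m(1) = y and d_m(γ_m(t), γ_m(t')) = d_m(x,y)·|t − t'| for all t, t' ∈ [0,1] (a minimizing geodesic for d_m parametrized with constant speed). Then there is a subsequence (γ_{m_j}) converging uniformly (with respect to d) to a continuous curve γ : [0,1] → X with γ(0) = x, γ(1) = y and d(γ(t), γ(t')) = d(x,y)·|t − t'| for all t, t' ∈ [0,1]; in particular γ is a minimizing geodesic for d between x and y. -/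
/-- `d` is a metric on the topological space `X` compatible with its topology:
it is symmetric, satisfies the triangle inequality, vanishes exactly on the diagonal,
and the topology generated by its open balls coincides with the given topology. -/
def IsCompatibleMetric (X : Type*) [t : TopologicalSpace X] (d : X → X → ℝ) : Prop :=
  (∀ a b, d a b = d b a) ∧
  (∀ a b c, d a c ≤ d a b + d b c) ∧
  (∀ a b, d a b = 0 ↔ a = b) ∧
  t = TopologicalSpace.generateFrom
        {s : Set X | ∃ a : X, ∃ ε : ℝ, 0 < ε ∧ s = {b | d a b < ε}}

open Filter Topology in
/-- An Arzelà–Ascoli theorem for sequences of (possibly discontinuous) maps that are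
only asymptotically uniformly equicontinuous. -/
theorem exists_subseq_tendstoUniformly_of_asymptotically_equicontinuous
    {T X : Type*} [PseudoMetricSpace T] [CompactSpace T] [Nonempty T]
    [MetricSpace X] [CompactSpace X] (f : ℕ → T → X)
    (hf : ∀ ε > 0, ∃ N : ℕ, ∃ δ > 0, ∀ n ≥ N, ∀ s t : T,
      dist s t < δ → dist (f n s) (f n t) < ε) :
    ∃ φ : ℕ → ℕ, StrictMono φ ∧ ∃ c : T → X,
      TendstoUniformly (fun j => f (φ j)) c atTop := by
  obtain ⟨u, hu⟩ := TopologicalSpace.exists_dense_seq T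
  obtain ⟨a, φ, hφ, ha⟩ := CompactSpace.tendsto_subseq (fun n k => f n (u k))
  have hpt : ∀ k, Tendsto (fun j => f (φ j) (u k)) atTop (𝓝 (a k)) :=
    fun k => tendsto_pi_nhds.1 ha k
  have hcauchy : UniformCauchySeqOn (fun j => f (φ j)) atTop Set.univ := by
    rw [Metric.uniformCauchySeqOn_iff]
    intro ε hε
    obtain ⟨N, δ, hδ, hN⟩ := hf (ε / 3) (by positivity)
    obtain ⟨F, hF⟩ := isCompact_univ.elim_finite_subcover
      (fun k => Metric.ball (u k) δ) (fun _ => Metric.isOpen_ball) (by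
        intro t _
        obtain ⟨k, hk⟩ := hu.exists_dist_lt t hδ
        exact Set.mem_iUnion.2 ⟨k, hk⟩)
    have hM : ∀ k, ∃ M, ∀ m ≥ M, ∀ n ≥ M, dist (f (φ m) (u k)) (f (φ n) (u k)) < ε / 3 :=
      fun k => Metric.cauchySeq_iff.1 (hpt k).cauchySeq (ε / 3) (by positivity)
    choose M hM using hM
    refine ⟨max N (F.sup M), fun m hm n hn t ht => ?_⟩
    obtain ⟨k, hkF, hk⟩ := Set.mem_iUnion₂.1 (hF ht)
    have hMk : M k ≤ F.sup M := Finset.le_sup hkF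
    have h₁ := hN (φ m) ((le_max_left _ _).trans (hm.trans (hφ.id_le m))) t (u k) hk
    have h₂ := hN (φ n) ((le_max_left _ _).trans (hn.trans (hφ.id_le n))) t (u k) hk
    have h₃ := hM k m (hMk.trans ((le_max_right _ _).trans hm)) n
      (hMk.trans ((le_max_right _ _).trans hn))
    rw [dist_comm] at h₂
    have := dist_triangle4 (f (φ m) t) (f (φ m) (u k)) (f (φ n) (u k)) (f (φ n) t)
    linarith
  have hlim : ∀ t, ∃ b, Tendsto (fun j => f (φ j) t) atTop (𝓝 b) := fun t =>
    cauchySeq_tendsto_of_complete (hcauchy.cauchySeq (Set.mem_univ t))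
  choose c hc using hlim
  exact ⟨φ, hφ, c, tendstoUniformlyOn_univ.1
    (hcauchy.tendstoUniformlyOn_of_tendsto fun t _ => hc t)⟩

/-- A compatible metric in the sense of `IsCompatibleMetric` is the distance of a metric space
structure whose topology is the given one. -/
abbrev IsCompatibleMetric.toMetricSpace {X : Type*} [TopologicalSpace X] {d : X → X → ℝ}
    (hd : IsCompatibleMetric X d) : MetricSpace X :=
  MetricSpace.ofDistTopology d (fun a => (hd.2.2.1 a a).2 rfl) hd.1 hd.2.1
    (fun s => by
      constructor
      · intro hs
        rw [hd.2.2.2] at hs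
        induction hs with
        | basic s hs =>
          obtain ⟨a, ε, -, rfl⟩ := hs
          intro b hb
          refine ⟨ε - d a b, sub_pos.2 hb, fun z hz => ?_⟩
          have := hd.2.1 a b z
          change d a z < ε
          linarith
        | univ => exact fun _ _ => ⟨1, one_pos, fun _ _ => trivial⟩
        | inter s t _ _ hs ht =>
          intro b hb
          obtain ⟨ε, hε, h⟩ := hs b hb.1
          obtain ⟨ε', hε', h'⟩ := ht b hb.2
          exact ⟨min ε ε', lt_min hε hε', fun z hz =>
            ⟨h z (hz.trans_le (min_le_left _ _)), h' z (hz.trans_le (min_le_right _ _))⟩⟩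
        | sUnion S _ hS =>
          intro b ⟨s, hs, hb⟩
          obtain ⟨ε, hε, h⟩ := hS s hs b hb
          exact ⟨ε, hε, fun z hz => ⟨s, hs, h z hz⟩⟩
      · intro hs
        rw [isOpen_iff_forall_mem_open]
        intro b hb
        obtain ⟨ε, hε, h⟩ := hs b hb
        refine ⟨{z | d b z < ε}, h, ?_, ?_⟩
        · rw [hd.2.2.2]
          exact TopologicalSpace.isOpen_generateFrom_of_mem ⟨b, ε, hε, rfl⟩
        · change d b b < ε
          rwa [(hd.2.2.1 b b).2 rfl])
    (fun a b => (hd.2.2.1 a b).1)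

/-- On a compact space `X`, let metrics `d_m` inducing the topology
converge uniformly to a metric `d` inducing the topology, and let `γ_m` be minimizing
constant-speed geodesics for `d_m` from `x` to `y`.  Then some subsequence `γ_{m_j}`
converges uniformly (w.r.t. `d`) to a continuous curve `γ` which is a minimizing
constant-speed geodesic for `d` from `x` to `y`. -/
theorem geodesics_subconverge {X : Type*} [TopologicalSpace X] [CompactSpace X]
    (dm : ℕ → X → X → ℝ) (d : X → X → ℝ)
    (hdm : ∀ m, IsCompatibleMetric X (dm m)) (hd : IsCompatibleMetric X d)
    (hconv : ∀ ε > 0, ∃ N : ℕ, ∀ m ≥ N, ∀ a b : X, |dm m a b - d a b| < ε)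
    (x y : X) (γ : ℕ → ℝ → X)
    (hγ0 : ∀ m, γ m 0 = x) (hγ1 : ∀ m, γ m 1 = y)
    (hgeo : ∀ m, ∀ t ∈ Set.Icc (0:ℝ) 1, ∀ t' ∈ Set.Icc (0:ℝ) 1,
      dm m (γ m t) (γ m t') = dm m x y * |t - t'|) :
    ∃ φ : ℕ → ℕ, StrictMono φ ∧ ∃ c : ℝ → X,
      ContinuousOn c (Set.Icc (0:ℝ) 1) ∧ c 0 = x ∧ c 1 = y ∧
      (∀ t ∈ Set.Icc (0:ℝ) 1, ∀ t' ∈ Set.Icc (0:ℝ) 1,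
        d (c t) (c t') = d x y * |t - t'|) ∧
      (∀ ε > 0, ∃ N : ℕ, ∀ j ≥ N, ∀ t ∈ Set.Icc (0:ℝ) 1, d (γ (φ j) t) (c t) < ε) := by
  let := hd.toMetricSpace
  have hdist : ∀ a b, dist a b = d a b := fun _ _ => rfl
  have hlim : Filter.Tendsto (fun m => dm m x y) Filter.atTop (nhds (d x y)) :=
    Metric.tendsto_atTop.2 fun ε hε => (hconv ε hε).imp fun N hN m hm => hN m hm x y
  obtain ⟨φ, hφ, c, hc⟩ := exists_subseq_tendstoUniformly_of_asymptotically_equicontinuous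
    (fun m (t : Set.Icc (0:ℝ) 1) => γ m t) (by
      intro ε hε
      obtain ⟨N, hN⟩ := hconv (min 1 (ε / 2)) (by positivity)
      have hpos : 0 < d x y + 1 := by have := dist_nonneg (x := x) (y := y); linarith [hdist x y]
      refine ⟨N, ε / 2 / (d x y + 1), by positivity, fun m hm s t hst => ?_⟩
      have h₁ := (abs_lt.1 (hN m hm (γ m s) (γ m t))).1
      have h₂ := (abs_lt.1 (hN m hm x y)).2
      have h₃ := min_le_left 1 (ε / 2)
      have h₄ := min_le_right 1 (ε / 2)
      rw [hgeo m s s.2 t t.2] at h₁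
      rw [Subtype.dist_eq, Real.dist_eq, lt_div_iff₀ hpos] at hst
      have h₅ : dm m x y * |(s : ℝ) - t| ≤ (d x y + 1) * |(s : ℝ) - t| :=
        mul_le_mul_of_nonneg_right (by linarith) (abs_nonneg _)
      change d (γ m s) (γ m t) < ε
      linarith)
  have hpt : ∀ t : Set.Icc (0:ℝ) 1, Filter.Tendsto (fun j => γ (φ j) t) Filter.atTop (nhds (c t)) :=
    fun t => hc.tendsto_at t
  have hcgeo : ∀ s t : Set.Icc (0:ℝ) 1, d (c s) (c t) = d x y * |(s : ℝ) - t| := by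
    intro s t
    have h₁ : Filter.Tendsto (fun j => d (γ (φ j) s) (γ (φ j) t)) Filter.atTop
        (nhds (d (c s) (c t))) := (hpt s).dist (hpt t)
    have h₂ : Filter.Tendsto (fun j => dm (φ j) (γ (φ j) s) (γ (φ j) t) -
        d (γ (φ j) s) (γ (φ j) t)) Filter.atTop (nhds 0) := by
      refine Metric.tendsto_atTop.2 fun ε hε => (hconv ε hε).imp fun N hN j hj => ?_
      rw [Real.dist_eq, sub_zero]
      exact hN _ (hj.trans (hφ.id_le j)) _ _
    have h₃ := (h₂.add h₁).congr fun j =>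
      (sub_add_cancel _ _).trans (hgeo (φ j) s s.2 t t.2)
    rw [zero_add] at h₃
    exact tendsto_nhds_unique h₃ ((hlim.comp hφ.tendsto_atTop).mul_const _)
  have hext : ∀ t (ht : t ∈ Set.Icc (0:ℝ) 1), Set.IccExtend zero_le_one c t = c ⟨t, ht⟩ :=
    fun t ht => Set.IccExtend_of_mem zero_le_one c ht
  have hccont : Continuous c :=
    (LipschitzWith.of_dist_le_mul (K := nndist x y) fun s t => (hcgeo s t).le).continuous
  refine ⟨φ, hφ, Set.IccExtend zero_le_one c, hccont.Icc_extend'.continuousOn, ?_, ?_, ?_, ?_⟩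
  · rw [hext 0 (by simp)]
    exact tendsto_nhds_unique (hpt ⟨0, by simp⟩) (by simp [hγ0])
  · rw [hext 1 (by simp)]
    exact tendsto_nhds_unique (hpt ⟨1, by simp⟩) (by simp [hγ1])
  · intro t ht t' ht'
    rw [hext t ht, hext t' ht']
    exact hcgeo ⟨t, ht⟩ ⟨t', ht'⟩
  · intro ε hε
    obtain ⟨N, hN⟩ := Filter.eventually_atTop.1 (Metric.tendstoUniformly_iff.1 hc ε hε)
    refine ⟨N, fun j hj t ht => ?_⟩
    rw [hext t ht, hd.1]
    exact hN j hj ⟨t, ht⟩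
end

section
/- Let X be a compact topological space. For each m ∈ ℕ let d_m : X × X → ℝ be a metric on X inducing the topology of X such that any two points a, b ∈ X are joined by a minimizing constant-speed geodesic for d_m (a continuous γ : [0,1] → X with γ(0) = a, γ(1) = b and d_m(γ(t), γ(t')) = d_m(a,b)·|t − t'| for all t, t'). Let d : X × X → ℝ be a metric inducing the topology of X with d_m → d uniformly on X × X. Then any two points of X are joined by a minimizing constant-speed geodesic for d; in particular d is an intrinsic (geodesic) metric. -/
open Filter Topology

namespace IsCompatibleMetric

variable {X : Type*} [TopologicalSpace X] {d : X → X → ℝ}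

theorem self_eq_zero (hd : IsCompatibleMetric X d) (a : X) : d a a = 0 :=
  (hd.2.2.1 a a).2 rfl

theorem nonneg (hd : IsCompatibleMetric X d) (a b : X) : 0 ≤ d a b := by
  have h := hd.2.1 a b a
  rw [hd.self_eq_zero, hd.1 b a] at h
  linarith

theorem isOpen_setOf_lt (hd : IsCompatibleMetric X d) (a : X) {ε : ℝ} (hε : 0 < ε) :
    IsOpen {b | d a b < ε} := by
  rw [hd.2.2.2]
  exact TopologicalSpace.isOpen_generateFrom_of_mem ⟨a, ε, hε, rfl⟩

theorem tendsto_nhds_iff (hd : IsCompatibleMetric X d) {ι : Type*} {l : Filter ι}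
    {f : ι → X} {x : X} :
    Tendsto f l (𝓝 x) ↔ Tendsto (fun i => d x (f i)) l (𝓝 0) := by
  constructor
  · intro h
    refine tendsto_order.2 ⟨fun c hc => Eventually.of_forall fun i => hc.trans_le (hd.nonneg _ _),
      fun c hc => ?_⟩
    exact h ((hd.isOpen_setOf_lt x hc).mem_nhds (by simpa [hd.self_eq_zero] using hc))
  · intro h
    have key := @TopologicalSpace.tendsto_nhds_generateFrom_iff ι X f l
      {s : Set X | ∃ a : X, ∃ ε : ℝ, 0 < ε ∧ s = {b | d a b < ε}} x
    rw [← hd.2.2.2] at key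
    refine key.2 ?_
    rintro s ⟨a, ε, -, rfl⟩ hx
    filter_upwards [h.eventually_lt_const (sub_pos.2 hx)] with i hi
    have := hd.2.1 a x (f i)
    simp only [Set.mem_preimage, Set.mem_ofPred_eq]
    linarith

theorem tendsto_apply (hd : IsCompatibleMetric X d) {ι : Type*} {l : Filter ι}
    {f g : ι → X} {x y : X} (hf : Tendsto f l (𝓝 x)) (hg : Tendsto g l (𝓝 y)) :
    Tendsto (fun i => d (f i) (g i)) l (𝓝 (d x y)) := by
  rw [tendsto_iff_dist_tendsto_zero]
  refine squeeze_zero (fun _ => dist_nonneg) (fun i => ?_)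
    (by simpa using (hd.tendsto_nhds_iff.1 hf).add (hd.tendsto_nhds_iff.1 hg))
  rw [Real.dist_eq, abs_le]
  have h₁ := hd.2.1 x (f i) y
  have h₂ := hd.2.1 (f i) (g i) y
  have h₃ := hd.2.1 (f i) x (g i)
  have h₄ := hd.2.1 x y (g i)
  rw [hd.1 (g i) y] at h₂
  rw [hd.1 (f i) x] at h₃
  constructor <;> linarith

theorem eq_of_tendsto_const (hd : IsCompatibleMetric X d) {ι : Type*} {l : Filter ι} [l.NeBot]
    {f : ι → X} {x a : X} (hf : Tendsto f l (𝓝 x)) (ha : ∀ i, f i = a) : x = a := by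
  have h := hd.tendsto_nhds_iff.1 hf
  simp only [ha] at h
  exact (hd.2.2.1 x a).1 (tendsto_nhds_unique tendsto_const_nhds h)

end IsCompatibleMetric

/-- On a compact space `X`, let metrics `d_m` inducing the topology
be such that any two points are joined by a minimizing constant-speed geodesic for
`d_m`, and suppose `d_m → d` uniformly, where `d` is a metric inducing the topology.
Then any two points of `X` are joined by a minimizing constant-speed geodesic for `d`;
in particular `d` is an intrinsic (geodesic) metric. -/
theorem limit_metric_is_geodesic {X : Type*} [TopologicalSpace X] [CompactSpace X]
    (dm : ℕ → X → X → ℝ) (d : X → X → ℝ)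
    (hdm : ∀ m, IsCompatibleMetric X (dm m)) (hd : IsCompatibleMetric X d)
    (hgeo : ∀ m : ℕ, ∀ a b : X, ∃ γ : ℝ → X,
      ContinuousOn γ (Set.Icc (0:ℝ) 1) ∧ γ 0 = a ∧ γ 1 = b ∧
      ∀ t ∈ Set.Icc (0:ℝ) 1, ∀ t' ∈ Set.Icc (0:ℝ) 1,
        dm m (γ t) (γ t') = dm m a b * |t - t'|)
    (hconv : ∀ ε > 0, ∃ N : ℕ, ∀ m ≥ N, ∀ a b : X, |dm m a b - d a b| < ε) :
    ∀ a b : X, ∃ γ : ℝ → X,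
      ContinuousOn γ (Set.Icc (0:ℝ) 1) ∧ γ 0 = a ∧ γ 1 = b ∧
      ∀ t ∈ Set.Icc (0:ℝ) 1, ∀ t' ∈ Set.Icc (0:ℝ) 1,
        d (γ t) (γ t') = d a b * |t - t'| := by
  intro a b
  choose γ _ hγ0 hγ1 hγ using fun m => hgeo m a b
  let U : Ultrafilter ℕ := hyperfilter ℕ
  have hU : (U : Filter ℕ) ≤ atTop := by
    rw [← Nat.cofinite_eq_atTop]
    exact hyperfilter_le_cofinite
  have hlim : ∀ t : ℝ, ∃ x : X, Tendsto (fun m => γ m t) U (𝓝 x) := fun t => by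
    obtain ⟨x, -, hx⟩ := isCompact_univ.ultrafilter_le_nhds (U.map fun m => γ m t) (by simp)
    exact ⟨x, hx⟩
  choose σ hσ using hlim
  have hdiff : ∀ u v : ℕ → X, Tendsto (fun m => dm m (u m) (v m) - d (u m) (v m)) U (𝓝 0) := by
    intro u v
    refine Tendsto.mono_left (Metric.tendsto_atTop.2 fun ε hε => ?_) hU
    obtain ⟨N, hN⟩ := hconv ε hε
    exact ⟨N, fun m hm => by simpa [Real.dist_eq] using hN m hm (u m) (v m)⟩
  have hab : Tendsto (fun m => dm m a b) U (𝓝 (d a b)) := by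
    simpa using (hdiff (fun _ => a) (fun _ => b)).add_const (d a b)
  have hgeod : ∀ t ∈ Set.Icc (0:ℝ) 1, ∀ t' ∈ Set.Icc (0:ℝ) 1,
      d (σ t) (σ t') = d a b * |t - t'| := by
    intro t ht t' ht'
    have h₁ := (hdiff (γ · t) (γ · t')).add (hd.tendsto_apply (hσ t) (hσ t'))
    simp only [sub_add_cancel, zero_add, hγ _ t ht t' ht'] at h₁
    exact tendsto_nhds_unique h₁ (hab.mul_const _)
  refine ⟨σ, fun t ht => ?_, hd.eq_of_tendsto_const (hσ 0) hγ0,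
    hd.eq_of_tendsto_const (hσ 1) hγ1, hgeod⟩
  refine hd.tendsto_nhds_iff.2 (Tendsto.congr' (f₁ := fun t' => d a b * |t - t'|) ?_ ?_)
  · filter_upwards [self_mem_nhdsWithin] with t' ht' using (hgeod t ht t' ht').symm
  · have hc : Continuous fun t' : ℝ => d a b * |t - t'| := by fun_prop
    simpa using (hc.tendsto t).mono_left nhdsWithin_le_nhds
end
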